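/- arXiv:2001.08627 — 2 statements merged into one kernel-verified Lean document; each statement's English description precedes it below -/
import Mathlib

section
/- Let φ be a semiflow on E satisfying (H1), (H2) with j = 2, (H3), (COM) and (S), let 𝔄 be its (nonempty) amenable set and ξ the flow on 𝔄 obtained by extending the restriction of φ to 𝔄. Let T ⊆ 𝔄 be an ε-transversal of ξ at some point, let w₀ ∈ E have bounded positive semi-orbit, let v₀ ∈ ω(w₀), and let v : ℝ → E be the complete trajectory with v(0) = v₀ (which lies in 𝔄). Then the trajectory v crosses T in at most one point: if v(t₁) ∈ T and v(t₂) ∈ T for some t₁, t₂ ∈ ℝ, then v(t₁) = v(t₂). -/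
open Set Filter Topology MeasureTheory Bornology

/-- A semiflow on a Banach space `E`. -/
structure Semiflow (E : Type*) [NormedAddCommGroup E] [NormedSpace ℝ E] where
  toFun : ℝ → E → E
  map_zero' : ∀ v : E, toFun 0 v = v
  map_add' : ∀ t s : ℝ, 0 ≤ t → 0 ≤ s → ∀ v : E, toFun (t + s) v = toFun t (toFun s v)
  continuousOn' : ContinuousOn (fun p : ℝ × E => toFun p.1 p.2) (Set.Ici (0 : ℝ) ×ˢ Set.univ)

/-- The open `r`-neighborhood `O_r(γ)` of a set `γ` in a normed space. -/
def setNbhd {E : Type*} [NormedAddCommGroup E] (γ : Set E) (r : ℝ) : Set E :=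
  {v | ∃ w ∈ γ, ‖v - w‖ < r}

/-- `S` is an `ε`-section at `x₀` of the (partial) flow `ξ` on the set `M`. -/
def IsSectionOn {X : Type*} [TopologicalSpace X] (M : Set X) (ξ : ℝ → X → X)
    (ε : ℝ) (x₀ : X) (S : Set X) : Prop :=
  x₀ ∈ S ∧ S ⊆ M ∧
    (∃ W : Set X, IsOpen W ∧ x₀ ∈ W ∧
      W ∩ M ⊆ ⋃ t ∈ Set.Icc (-ε) ε, ξ t '' S) ∧
    ∀ y ∈ ⋃ t ∈ Set.Icc (-ε) ε, ξ t '' S,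
      ∃! p : ℝ × X, p.1 ∈ Set.Icc (-ε) ε ∧ p.2 ∈ S ∧ ξ p.1 p.2 = y

/-- `T` is an `ε`-transversal at `x₀` of the (partial) flow `ξ` on the set `M`:
an `ε`-section which is the image of a topological embedding of `[-1,1]`,
with `x₀` corresponding to an interior point. -/
def IsTransversalOn {X : Type*} [TopologicalSpace X] (M : Set X) (ξ : ℝ → X → X)
    (ε : ℝ) (x₀ : X) (T : Set X) : Prop :=
  IsSectionOn M ξ ε x₀ T ∧
    ∃ h : ℝ → X, ContinuousOn h (Set.Icc (-1 : ℝ) 1) ∧ Set.InjOn h (Set.Icc (-1 : ℝ) 1) ∧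
      h '' Set.Icc (-1 : ℝ) 1 = T ∧ ∃ s₀ ∈ Set.Ioo (-1 : ℝ) 1, h s₀ = x₀

namespace Semiflow

variable {E : Type*} [NormedAddCommGroup E] [NormedSpace ℝ E]
variable {H : Type*} [NormedAddCommGroup H] [InnerProductSpace ℝ H]

/-- A stationary point of the semiflow. -/
def IsStationary (φ : Semiflow E) (v₀ : E) : Prop :=
  ∀ t : ℝ, 0 ≤ t → φ.toFun t v₀ = v₀

/-- A periodic (non-stationary) point of the semiflow. -/
def IsPeriodicPt (φ : Semiflow E) (v₀ : E) : Prop :=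
  ¬ φ.IsStationary v₀ ∧ ∃ σ : ℝ, 0 < σ ∧ φ.toFun σ v₀ = v₀

/-- The positive semi-orbit `γ⁺(v₀)` (which equals the full orbit for periodic points). -/
def orbit (φ : Semiflow E) (v₀ : E) : Set E :=
  {w | ∃ t : ℝ, 0 ≤ t ∧ φ.toFun t v₀ = w}

/-- `γ` is a periodic orbit of the semiflow. -/
def IsPeriodicOrbit (φ : Semiflow E) (γ : Set E) : Prop :=
  ∃ v₀ : E, φ.IsPeriodicPt v₀ ∧ γ = φ.orbit v₀

/-- The ω-limit set of a point. -/
def omegaLimit (φ : Semiflow E) (v₀ : E) : Set E :=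
  ⋂ s ∈ Set.Ici (0 : ℝ), closure {w | ∃ t : ℝ, s ≤ t ∧ φ.toFun t v₀ = w}

/-- A complete trajectory of the semiflow. -/
def IsCompleteTrajectory (φ : Semiflow E) (v : ℝ → E) : Prop :=
  Continuous v ∧ ∀ t : ℝ, 0 ≤ t → ∀ s : ℝ, v (t + s) = φ.toFun t (v s)

/-- The α-limit set of a complete trajectory. -/
def alphaLimitOf (φ : Semiflow E) (v : ℝ → E) : Set E :=
  ⋂ s ∈ Set.Iic (0 : ℝ), closure {w | ∃ t : ℝ, t ≤ s ∧ v t = w}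

/-- Hypothesis (H1): `P` is symmetric and positive on `Eplus`, negative on `Eminus`,
with `E = Eplus ⊕ Eminus`. -/
def IsH1 (P : E →L[ℝ] E →L[ℝ] ℝ) (Eplus Eminus : Submodule ℝ E) : Prop :=
  (∀ v w : E, P v w = P w v) ∧ IsClosed (Eplus : Set E) ∧ IsClosed (Eminus : Set E) ∧
    IsCompl Eplus Eminus ∧
    (∀ v ∈ Eplus, v ≠ 0 → 0 < P v v) ∧ (∀ v ∈ Eminus, v ≠ 0 → P v v < 0)

/-- Hypothesis (H3): squeezing with respect to `V(v) = ⟨v, Pv⟩`, with parameters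
`δ > 0`, `τV ≥ 0`, `ν > 0`; the embedding `E ↪ H` is `ι`. -/
def IsH3 (φ : Semiflow E) (ι : E →L[ℝ] H) (P : E →L[ℝ] E →L[ℝ] ℝ) (δ τV ν : ℝ) : Prop :=
  0 < δ ∧ 0 ≤ τV ∧ 0 < ν ∧
    ∀ v₁ v₂ : E, ∀ l r : ℝ, 0 ≤ l → l ≤ r → τV ≤ r - l →
      Real.exp (2 * ν * r) *
          P (φ.toFun r v₁ - φ.toFun r v₂) (φ.toFun r v₁ - φ.toFun r v₂) -
        Real.exp (2 * ν * l) *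
          P (φ.toFun l v₁ - φ.toFun l v₂) (φ.toFun l v₁ - φ.toFun l v₂) ≤
      -δ * ∫ s in l..r, Real.exp (2 * ν * s) * ‖ι (φ.toFun s v₁) - ι (φ.toFun s v₂)‖ ^ 2

/-- Hypothesis (COM): some time-`τ` map takes bounded sets to precompact sets. -/
def IsCOM (φ : Semiflow E) : Prop :=
  ∃ τ : ℝ, 0 < τ ∧ ∀ B : Set E, IsBounded B → IsCompact (closure (φ.toFun τ '' B))

/-- Hypothesis (S): a smoothing estimate from `H` to `E`. -/
def IsSmoothing (φ : Semiflow E) (ι : E →L[ℝ] H) : Prop :=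
  ∃ τ C : ℝ, 0 ≤ τ ∧ 0 < C ∧
    ∀ v₁ v₂ : E, ‖φ.toFun τ v₁ - φ.toFun τ v₂‖ ≤ C * ‖ι v₁ - ι v₂‖

/-- An amenable trajectory: a complete trajectory with
`∫_{-∞}^0 e^{2νs} |v(s)|²_H ds < ∞`. -/
def IsAmenableTrajectory (φ : Semiflow E) (ι : E →L[ℝ] H) (ν : ℝ) (v : ℝ → E) : Prop :=
  φ.IsCompleteTrajectory v ∧
    IntegrableOn (fun s : ℝ => Real.exp (2 * ν * s) * ‖ι (v s)‖ ^ 2) (Set.Iic (0 : ℝ))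

/-- The amenable set `𝔄`: points through which an amenable trajectory passes. -/
def amenableSet (φ : Semiflow E) (ι : E →L[ℝ] H) (ν : ℝ) : Set E :=
  {v₀ | ∃ v : ℝ → E, φ.IsAmenableTrajectory ι ν v ∧ v 0 = v₀}

/-- Orbital stability of a set `γ`. -/
def IsOrbitallyStable (φ : Semiflow E) (γ : Set E) : Prop :=
  ∀ ε : ℝ, 0 < ε → ∃ δ : ℝ, 0 < δ ∧
    ∀ v ∈ setNbhd γ δ, ∀ t : ℝ, 0 ≤ t → φ.toFun t v ∈ setNbhd γ ε

/-- Amenable stability: orbital stability with respect to initial data in `𝔄`. -/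
def IsAmenableStable (φ : Semiflow E) (ι : E →L[ℝ] H) (ν : ℝ) (γ : Set E) : Prop :=
  ∀ ε : ℝ, 0 < ε → ∃ δ : ℝ, 0 < δ ∧
    ∀ v ∈ setNbhd γ δ ∩ φ.amenableSet ι ν, ∀ t : ℝ, 0 ≤ t → φ.toFun t v ∈ setNbhd γ ε

/-- Lyapunov stability of a stationary point. -/
def IsLyapunovStable (φ : Semiflow E) (v₀ : E) : Prop :=
  ∀ ε : ℝ, 0 < ε → ∃ δ : ℝ, 0 < δ ∧
    ∀ v : E, ‖v - v₀‖ < δ → ∀ t : ℝ, 0 ≤ t → ‖φ.toFun t v - v₀‖ < ε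

/-- `D` is a `k`-dimensional local unstable set for the stationary point `v₀`:
(U1) `D` is a homeomorphic image of an open `k`-cube; (U2) through every point of `D`
there is a unique complete trajectory, converging to `v₀` as `t → -∞`;
(U3) trajectories through points of `D` near `v₀` stay near `v₀` for `t ≤ 0`. -/
def IsLocalUnstableSet (φ : Semiflow E) (k : ℕ) (v₀ : E) (D : Set E) : Prop :=
  v₀ ∈ D ∧
    Nonempty (↥(Set.pi Set.univ fun _ : Fin k => Set.Ioo (0 : ℝ) 1) ≃ₜ ↥D) ∧
    (∀ w₀ ∈ D, ∃! w : ℝ → E, φ.IsCompleteTrajectory w ∧ w 0 = w₀) ∧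
    (∀ w₀ ∈ D, ∀ w : ℝ → E, φ.IsCompleteTrajectory w → w 0 = w₀ →
      Filter.Tendsto w Filter.atBot (nhds v₀)) ∧
    (∀ ε : ℝ, 0 < ε → ∃ δ : ℝ, 0 < δ ∧ ∀ w₀ ∈ D, ‖w₀ - v₀‖ < δ →
      ∀ w : ℝ → E, φ.IsCompleteTrajectory w → w 0 = w₀ → ∀ t : ℝ, t ≤ 0 → ‖w t - v₀‖ < ε)

/-- An unstable terminal point: a stationary point with a 2-dimensional local unstable set. -/
def IsUnstableTerminal (φ : Semiflow E) (v₀ : E) : Prop :=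
  φ.IsStationary v₀ ∧ ∃ D : Set E, φ.IsLocalUnstableSet 2 v₀ D

/-- A terminal point: a stationary point that is Lyapunov stable or has a
2-dimensional local unstable set. -/
def IsTerminal (φ : Semiflow E) (v₀ : E) : Prop :=
  φ.IsStationary v₀ ∧
    (φ.IsLyapunovStable v₀ ∨ ∃ D : Set E, φ.IsLocalUnstableSet 2 v₀ D)

/-- An attractor: a bounded closed set with an open neighborhood all of whose points have
precompact positive semi-orbits with ω-limit sets inside the set. -/
def IsAttractor (φ : Semiflow E) (A : Set E) : Prop :=
  IsBounded A ∧ IsClosed A ∧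
    ∃ U : Set E, IsOpen U ∧ A ⊆ U ∧
      ∀ v₀ ∈ U, IsCompact (closure (φ.orbit v₀)) ∧ φ.omegaLimit v₀ ⊆ A

/-- `Pi` is the `V`-orthogonal projector onto `Eminus`. -/
def IsVProjector (P : E →L[ℝ] E →L[ℝ] ℝ) (Eminus : Submodule ℝ E) (Pi : E → E) : Prop :=
  ∀ v : E, Pi v ∈ Eminus ∧ ∀ w ∈ Eminus, P w v = P w (Pi v)

/-- The interior region `𝒢_γ ⊆ 𝔄` of a periodic orbit `γ`: the preimage under `Π`
of the bounded connected component of `E⁻ \ Πγ`. -/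
def interiorRegion (φ : Semiflow E) (ι : E →L[ℝ] H) (ν : ℝ) (Eminus : Submodule ℝ E)
    (Pi : E → E) (γ : Set E) : Set E :=
  {a | a ∈ φ.amenableSet ι ν ∧ Pi a ∈ (Eminus : Set E) \ (Pi '' γ) ∧
    IsBounded (connectedComponentIn ((Eminus : Set E) \ (Pi '' γ)) (Pi a))}

/-- The partial order `γ₁ ⩽ γ₂` on periodic orbits: `𝒢_{γ₁} ⊆ 𝒢_{γ₂}`. -/
def orbitLE (φ : Semiflow E) (ι : E →L[ℝ] H) (ν : ℝ) (Eminus : Submodule ℝ E)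
    (Pi : E → E) (γ₁ γ₂ : Set E) : Prop :=
  φ.interiorRegion ι ν Eminus Pi γ₁ ⊆ φ.interiorRegion ι ν Eminus Pi γ₂

/-- External stability of a periodic orbit `γ`. -/
def IsExternallyStable (φ : Semiflow E) (ι : E →L[ℝ] H) (ν : ℝ) (Eminus : Submodule ℝ E)
    (Pi : E → E) (γ : Set E) : Prop :=
  (∃ g : ℕ → Set E, (∀ k, φ.IsPeriodicOrbit (g k)) ∧ (∀ k, g k ≠ γ) ∧
      (∀ k, φ.orbitLE ι ν Eminus Pi γ (g k)) ∧
      Filter.Tendsto (fun k => Metric.hausdorffDist (g k) γ) Filter.atTop (nhds 0)) ∨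
    (∃ v₀ ∈ φ.amenableSet ι ν \ closure (φ.interiorRegion ι ν Eminus Pi γ),
      φ.omegaLimit v₀ = γ)

/-- Internal stability of a periodic orbit `γ`. -/
def IsInternallyStable (φ : Semiflow E) (ι : E →L[ℝ] H) (ν : ℝ) (Eminus : Submodule ℝ E)
    (Pi : E → E) (γ : Set E) : Prop :=
  (∃ g : ℕ → Set E, (∀ k, φ.IsPeriodicOrbit (g k)) ∧ (∀ k, g k ≠ γ) ∧
      (∀ k, φ.orbitLE ι ν Eminus Pi (g k) γ) ∧
      Filter.Tendsto (fun k => Metric.hausdorffDist (g k) γ) Filter.atTop (nhds 0)) ∨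
    (∃ v₀ ∈ φ.interiorRegion ι ν Eminus Pi γ, φ.omegaLimit v₀ = γ)

end Semiflow

open Set Filter Topology MeasureTheory Bornology

namespace PlaneAux
open unitInterval

/-- joint lift of a family of nonvanishing paths, normalized at time `0`. -/
lemma exists_joint {A : Type*} [TopologicalSpace A] (F : I → A → ℂ)
    (hF : Continuous (fun p : I × A => F p.1 p.2)) (h0 : ∀ s y, F s y ≠ 0) :
    ∃ L : I × A → ℂ, Continuous L ∧ (∀ y, L (0, y) = 0) ∧
      ∀ s y, Complex.exp (L (s, y)) * F 0 y = F s y := by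
  have hc : Continuous (fun p : I × A => F p.1 p.2 / F 0 p.2) := by
    refine hF.div ?_ (fun p => h0 _ _)
    exact hF.comp (continuous_const.prodMk continuous_snd)
  let G : C(I × A, {z : ℂ // z ≠ 0}) :=
    ⟨fun p => ⟨F p.1 p.2 / F 0 p.2, div_ne_zero (h0 _ _) (h0 _ _)⟩, hc.subtype_mk _⟩
  have hG0 : ∀ a, G (0, a) =
      (fun z : ℂ ↦ (⟨_, z.exp_ne_zero⟩ : {z : ℂ // z ≠ 0})) ((ContinuousMap.const A (0:ℂ)) a) := by
    intro a
    apply Subtype.ext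
    simp [G, div_self (h0 0 a)]
  refine ⟨Complex.isCoveringMap_exp.liftHomotopy G (ContinuousMap.const A 0) hG0,
    ContinuousMap.continuous _, fun y => ?_, fun s y => ?_⟩
  · exact Complex.isCoveringMap_exp.liftHomotopy_zero G _ hG0 y
  · have := congrFun (Complex.isCoveringMap_exp.liftHomotopy_lifts G _ hG0) (s, y)
    have h2 := congrArg Subtype.val this
    simp only [Function.comp] at h2
    rw [h2]
    exact div_mul_cancel₀ _ (h0 0 y)

lemma exists_lift (γ : I → ℂ) (hγ : Continuous γ) (h0 : ∀ s, γ s ≠ 0) :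
    ∃ L : I → ℂ, Continuous L ∧ L 0 = 0 ∧ ∀ s, Complex.exp (L s) * γ 0 = γ s := by
  obtain ⟨L, hL, hL0, hLe⟩ := exists_joint (A := Unit) (fun s _ => γ s)
    (hγ.comp continuous_fst) (fun s _ => h0 s)
  exact ⟨fun s => L (s, ()), hL.comp (by fun_prop), hL0 _, fun s => hLe s _⟩

open Classical in
/-- variation of the logarithm along a nonvanishing path -/
noncomputable def vlog (γ : I → ℂ) : ℂ :=
  if h : Continuous γ ∧ ∀ s, γ s ≠ 0 then (exists_lift γ h.1 h.2).choose 1 else 0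

/-- a continuous function on a preconnected space with `exp = 1` is constant. -/
lemma const_of_exp {A : Type*} [TopologicalSpace A] [PreconnectedSpace A] (f : A → ℂ)
    (hf : Continuous f) (h1 : ∀ y, Complex.exp (f y) = 1) (y z : A) : f y = f z := by
  have h2 : ∀ y, ∃ n : ℤ, f y = n * (2 * Real.pi * Complex.I) := fun y =>
    Complex.exp_eq_one_iff.1 (h1 y)
  choose n hn using h2
  have hnc : Continuous n := by
    rw [Int.isClosedEmbedding_coe_real.isInducing.continuous_iff]
    have : ((fun k : ℤ => (k : ℝ)) ∘ n) = fun y => (f y).im / (2 * Real.pi) := by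
      funext y
      have := Real.pi_pos
      simp [hn y]
    rw [this]
    fun_prop
  have : n y = n z := PreconnectedSpace.constant ‹_› hnc
  rw [hn, hn, this]

lemma vlog_eq (γ : I → ℂ) (hγ : Continuous γ) (h0 : ∀ s, γ s ≠ 0) (L : I → ℂ)
    (hL : Continuous L) (hLe : ∀ s, Complex.exp (L s) * γ 0 = γ s * Complex.exp (L 0)) :
    vlog γ = L 1 - L 0 := by
  have h : Continuous γ ∧ ∀ s, γ s ≠ 0 := ⟨hγ, h0⟩
  unfold vlog
  rw [dif_pos h]
  set M := (exists_lift γ h.1 h.2).choose with hM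
  obtain ⟨hMc, hM0, hMe⟩ := (exists_lift γ h.1 h.2).choose_spec
  rw [← hM] at hMc hM0 hMe
  have key := const_of_exp (fun s => M s - (L s - L 0)) (by fun_prop) (fun s => by
    rw [Complex.exp_sub, Complex.exp_sub]
    have e1 := hMe s
    have e2 := hLe s
    have hne := Complex.exp_ne_zero (L s)
    have hne0 := Complex.exp_ne_zero (L 0)
    rw [← e1] at e2
    have e3 : Complex.exp (L s) = Complex.exp (M s) * Complex.exp (L 0) := by
      apply mul_right_cancel₀ (h0 0); rw [e2]; ring
    rw [e3]
    have := Complex.exp_ne_zero (M s)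
    field_simp) 1 0
  simp only [hM0, sub_self] at key
  exact sub_eq_zero.1 key

lemma slice {A : Type*} [TopologicalSpace A] {F : I → A → ℂ}
    (hF : Continuous (fun p : I × A => F p.1 p.2)) (y : A) : Continuous (fun s => F s y) :=
  hF.comp (continuous_id.prodMk continuous_const)

lemma vlog_cont {A : Type*} [TopologicalSpace A] (F : I → A → ℂ)
    (hF : Continuous (fun p : I × A => F p.1 p.2)) (h0 : ∀ s y, F s y ≠ 0) :
    Continuous (fun y => vlog (fun s => F s y)) := by
  obtain ⟨L, hL, hL0, hLe⟩ := exists_joint F hF h0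
  have : (fun y => vlog (fun s => F s y)) = fun y => L (1, y) := by
    funext y
    rw [vlog_eq (fun s => F s y) (slice hF y) (fun s => h0 s y) (fun s => L (s, y))
      (hL.comp (continuous_id.prodMk continuous_const)) (fun s => by simp [hL0, hLe])]
    simp [hL0]
  rw [this]
  exact hL.comp (by fun_prop)

lemma exp_vlog (γ : I → ℂ) (hγ : Continuous γ) (h0 : ∀ s, γ s ≠ 0) :
    Complex.exp (vlog γ) = γ 1 / γ 0 := by
  obtain ⟨L, hL, hL0, hLe⟩ := exists_lift γ hγ h0
  rw [vlog_eq γ hγ h0 L hL (fun s => by simp [hL0, hLe]), hL0, sub_zero, ← hLe 1,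
    mul_div_cancel_right₀ _ (h0 0)]

lemma vlog_reverse_neg (γ : I → ℂ) (hγ : Continuous γ) (h0 : ∀ s, γ s ≠ 0) :
    vlog (fun s => - γ (σ s)) = - vlog γ := by
  obtain ⟨L, hL, hL0, hLe⟩ := exists_lift γ hγ h0
  rw [vlog_eq γ hγ h0 L hL (fun s => by simp [hL0, hLe]),
    vlog_eq (fun s => - γ (σ s)) (hγ.comp unitInterval.continuous_symm).neg (fun s => neg_ne_zero.2 (h0 _)) (fun s => L (σ s))
      (hL.comp (by fun_prop)) (fun s => by
        have h1 := hLe 1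
        have h2 := hLe (σ s)
        simp only [unitInterval.symm_zero]
        rw [← h1, ← h2]; ring)]
  simp

lemma vlog_diff_const {A : Type*} [TopologicalSpace A] [PreconnectedSpace A] (F G : I → A → ℂ)
    (hF : Continuous (fun p : I × A => F p.1 p.2)) (hF0 : ∀ s y, F s y ≠ 0)
    (hG : Continuous (fun p : I × A => G p.1 p.2)) (hG0 : ∀ s y, G s y ≠ 0)
    (h0 : ∀ y, F 0 y = G 0 y) (h1 : ∀ y, F 1 y = G 1 y) (y z : A) :
    vlog (fun s => F s y) - vlog (fun s => G s y) =
      vlog (fun s => F s z) - vlog (fun s => G s z) := by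
  refine const_of_exp (fun y => vlog (fun s => F s y) - vlog (fun s => G s y))
    ((vlog_cont F hF hF0).sub (vlog_cont G hG hG0)) (fun y => ?_) y z
  rw [Complex.exp_sub, exp_vlog _ (slice hF y) (fun s => hF0 s y),
    exp_vlog _ (slice hG y) (fun s => hG0 s y), h0, h1]
  exact div_self (div_ne_zero (hG0 _ _) (hG0 _ _))

lemma vlog_const {A : Type*} [TopologicalSpace A] [PreconnectedSpace A] (F : I → A → ℂ)
    (hF : Continuous (fun p : I × A => F p.1 p.2)) (hF0 : ∀ s y, F s y ≠ 0)
    (a b : ℂ) (h0 : ∀ y, F 0 y = a) (h1 : ∀ y, F 1 y = b) (y z : A) :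
    vlog (fun s => F s y) = vlog (fun s => F s z) := by
  have := vlog_diff_const F (fun s _ => F s y) hF hF0
    ((hF.comp (by fun_prop : Continuous (fun s : I => (s, y)))).comp continuous_fst)
    (fun s _ => hF0 s y)
    (fun w => by rw [h0, h0]) (fun w => by rw [h1, h1]) y z
  exact sub_left_injective this

/-- The family of elliptical arcs from `-1` to `1`. -/
noncomputable def arc (k : ℝ) (θ : I) : ℂ :=
  ⟨-Real.cos (Real.pi * θ), k * Real.sin (Real.pi * θ)⟩

/-- The square -/
def sq : Set ℂ := {z | |z.re| ≤ 1 ∧ |z.im| ≤ 1}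

lemma continuous_mk' {X : Type*} [TopologicalSpace X] {f g : X → ℝ} (hf : Continuous f)
    (hg : Continuous g) : Continuous (fun x => (⟨f x, g x⟩ : ℂ)) := by
  have : (fun x => (⟨f x, g x⟩ : ℂ)) = fun x => (f x : ℂ) + g x * Complex.I := by
    funext x; apply Complex.ext <;> simp
  rw [this]; fun_prop

lemma sin_nonneg' (θ : I) : 0 ≤ Real.sin (Real.pi * θ) := by
  apply Real.sin_nonneg_of_nonneg_of_le_pi
  · exact mul_nonneg Real.pi_pos.le θ.2.1
  · nlinarith [Real.pi_pos, θ.2.2]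

lemma arc_mem {k : ℝ} (hk : |k| ≤ 1) (θ : I) : arc k θ ∈ sq := by
  refine ⟨?_, ?_⟩
  · simp only [arc, abs_neg]; exact Real.abs_cos_le_one _
  · simp only [arc, abs_mul]
    exact mul_le_one₀ hk (abs_nonneg _) (Real.abs_sin_le_one _)

lemma smul_mem_sq {z : ℂ} (hz : z ∈ sq) {c : ℝ} (hc : |c| ≤ 1) : (c : ℂ) * z ∈ sq := by
  refine ⟨?_, ?_⟩
  · simp only [Complex.mul_re, Complex.ofReal_re, Complex.ofReal_im, zero_mul, sub_zero, abs_mul]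
    exact mul_le_one₀ hc (abs_nonneg _) hz.1
  · simp only [Complex.mul_im, Complex.ofReal_re, Complex.ofReal_im, zero_mul, add_zero, abs_mul]
    exact mul_le_one₀ hc (abs_nonneg _) hz.2

@[simp] lemma arc_zero (k : ℝ) : arc k 0 = -1 := by
  apply Complex.ext <;> simp [arc]
@[simp] lemma arc_one (k : ℝ) : arc k 1 = 1 := by
  apply Complex.ext <;> simp [arc]

lemma arc_neg (θ : I) : arc (-1) θ = - arc 1 (σ θ) := by
  apply Complex.ext <;> simp [arc, mul_sub, Real.cos_pi_sub, Real.sin_pi_sub]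

lemma arc_ne_zero {k : ℝ} (hk : k ≠ 0) (θ : I) : arc k θ ≠ 0 := by
  intro h
  have h1 := congrArg Complex.re h
  have h2 := congrArg Complex.im h
  simp only [arc, Complex.zero_re, Complex.zero_im, neg_eq_zero, mul_eq_zero, hk, false_or] at h1 h2
  have := Real.sin_sq_add_cos_sq (Real.pi * θ)
  rw [h1, h2] at this; norm_num at this

set_option maxHeartbeats 1000000 in
/-- Borsuk-type lemma. -/
lemma borsuk (g : ℂ → ℂ) (hg : ContinuousOn g sq) (hinj : InjOn g sq) :
    vlog (fun θ => g (arc 1 θ) - g 0) ≠ vlog (fun θ => g (arc (-1) θ) - g 0) := by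
  -- the homotopy
  let F : ℝ → I → I → ℂ := fun k θ t =>
    g (((1 / (1 + (t:ℝ)) : ℝ) : ℂ) * arc k θ) - g (((-(t:ℝ) / (1 + (t:ℝ)) : ℝ) : ℂ) * arc k θ)
  have hpos : ∀ t : I, 0 < 1 + (t:ℝ) := fun t => by have := t.2.1; linarith
  have b1 : ∀ t : I, |1 / (1 + (t:ℝ))| ≤ 1 := fun t => by
    rw [abs_of_pos (by have := hpos t; positivity), div_le_one (hpos t)]
    linarith [t.2.1]
  have b2 : ∀ t : I, |-(t:ℝ) / (1 + (t:ℝ))| ≤ 1 := fun t => by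
    rw [abs_div, abs_neg, abs_of_nonneg t.2.1, abs_of_pos (hpos t), div_le_one (hpos t)]
    linarith
  have hc : ∀ k : ℝ, |k| ≤ 1 → Continuous (fun p : I × I => F k p.1 p.2) := by
    intro k hk
    have hne : ∀ p : I × I, 1 + (p.2 : ℝ) ≠ 0 := fun p => (hpos p.2).ne'
    have harc : Continuous (fun p : I × I => arc k p.1) :=
      continuous_mk' (by fun_prop) (by fun_prop)
    refine Continuous.sub ?_ ?_
    · refine hg.comp_continuous ?_ (fun p => smul_mem_sq (arc_mem hk _) (b1 _))
      exact (Complex.continuous_ofReal.comp (by fun_prop (disch := exact hne))).mul harc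
    · refine hg.comp_continuous ?_ (fun p => smul_mem_sq (arc_mem hk _) (b2 _))
      exact (Complex.continuous_ofReal.comp (by fun_prop (disch := exact hne))).mul harc
  have hn : ∀ k : ℝ, |k| ≤ 1 → k ≠ 0 → ∀ θ t, F k θ t ≠ 0 := by
    intro k hk hk0 θ t h
    have := hinj (smul_mem_sq (arc_mem hk _) (b1 _)) (smul_mem_sq (arc_mem hk _) (b2 _))
      (sub_eq_zero.1 h)
    have h3 := mul_right_cancel₀ (arc_ne_zero hk0 θ) this
    have h4 : 1 / (1 + (t:ℝ)) = -(t:ℝ) / (1 + (t:ℝ)) := by exact_mod_cast h3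
    rw [div_left_inj' (hpos t).ne'] at h4
    have := t.2.1
    linarith
  have key := vlog_diff_const (F 1) (F (-1)) (hc 1 (by simp)) (hn 1 (by simp) (by simp))
    (hc (-1) (by simp)) (hn (-1) (by simp) (by simp)) (fun y => by simp [F])
    (fun y => by simp [F]) 0 1
  have e0 : ∀ k, (fun s => F k s 0) = fun θ => g (arc k θ) - g 0 := by
    intro k; funext s; simp [F]
  have e1 : (fun s => F (-1) s 1) = fun s => - (fun s => F 1 s 1) (σ s) := by
    funext s
    simp only [F, arc_neg, neg_sub, Set.Icc.coe_one, mul_neg]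
    have : ((-1 / (1 + 1) : ℝ) : ℂ) = - ((1 / (1+1) : ℝ) : ℂ) := by push_cast; ring
    rw [this]
    simp only [neg_mul, neg_neg]
  rw [e0, e0, e1, vlog_reverse_neg _ (slice (hc 1 (by simp)) 1)
    (fun s => hn 1 (by simp) (by simp) s 1)] at key
  intro h
  rw [h, sub_self] at key
  have h5 : vlog (fun s => F 1 s 1) = 0 := by
    have : 2 * vlog (fun s => F 1 s 1) = 0 := by rw [key]; ring
    simpa using this
  have h6 := exp_vlog (fun s => F 1 s 1) (slice (hc 1 (by simp)) 1)
    (fun s => hn 1 (by simp) (by simp) s 1)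
  rw [h5, Complex.exp_zero] at h6
  have h7 : F 1 1 1 = - F 1 0 1 := by
    simp only [F, arc_zero, arc_one, mul_neg, mul_one, Set.Icc.coe_one, neg_sub]
    have : ((-1 / (1 + 1) : ℝ) : ℂ) = - ((1 / (1+1) : ℝ) : ℂ) := by push_cast; ring
    rw [this, neg_neg]
  rw [h7, neg_div, div_self (hn 1 (by simp) (by simp) 0 1)] at h6
  norm_num at h6

lemma eq_zero_of_exp {x : ℂ} (h : Complex.exp x = 1) (hx : ‖x‖ < 1) : x = 0 := by
  obtain ⟨n, hn⟩ := Complex.exp_eq_one_iff.1 h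
  rcases eq_or_ne n 0 with h0 | h0
  · simp [hn, h0]
  · exfalso
    rw [hn] at hx
    simp only [norm_mul, Complex.norm_intCast, Complex.norm_ofNat, Complex.norm_real,
      Complex.norm_I, mul_one, Real.norm_eq_abs, abs_of_pos Real.pi_pos] at hx
    have h1 : (1:ℝ) ≤ |(n:ℝ)| := by exact_mod_cast Int.one_le_abs h0
    nlinarith [Real.pi_gt_three]

/-- the closed curve -/
def crv (g : ℂ → ℂ) (α : I → ℂ) : Set ℂ := range α ∪ g '' {z | z.im = 0 ∧ |z.re| ≤ 1}

lemma arc0_mem (θ : I) : arc 0 θ ∈ {z : ℂ | z.im = 0 ∧ |z.re| ≤ 1} :=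
  ⟨by simp [arc], (arc_mem (by simp) θ).1⟩

lemma continuous_arc : Continuous (fun p : I × ℝ => arc p.2 p.1) :=
  continuous_mk' (by fun_prop) (by fun_prop)

lemma continuous_arc' (k : ℝ) : Continuous (arc k) :=
  continuous_mk' (by fun_prop) (by fun_prop)

lemma iy_mem {y : ℝ} (hy : |y| ≤ 1/2) : (⟨0, y⟩ : ℂ) ∈ sq :=
  ⟨by simp, by simp only; linarith⟩

lemma arc_ne_iy {k y : ℝ} (θ : I) (h : (0 ≤ k ∧ y < 0) ∨ (k ≤ 0 ∧ 0 < y)) :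
    arc k θ ≠ ⟨0, y⟩ := by
  intro e
  have h2 := congrArg Complex.im e
  simp only [arc] at h2
  have h3 := sin_nonneg' θ
  rcases h with ⟨h, h'⟩ | ⟨h, h'⟩
  · have := mul_nonneg h h3; linarith
  · have := mul_nonneg (neg_nonneg.2 h) h3; linarith

lemma arc_ne_iy' {k y : ℝ} (θ : I) (hk : |k| = 1) (hy : |y| ≤ 1/2) :
    arc k θ ≠ ⟨0, y⟩ := by
  intro e
  have h1 := congrArg Complex.re e
  have h2 := congrArg Complex.im e
  simp only [arc, neg_eq_zero] at h1 h2
  have h3 := Real.sin_sq_add_cos_sq (Real.pi * θ)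
  rw [h1] at h3
  have h4 : |y| ^ 2 = 1 := by
    rw [← h2, abs_mul, hk, one_mul, sq_abs]; linarith
  have := abs_nonneg y
  nlinarith

set_option maxHeartbeats 1000000 in
theorem planar_region (g : ℂ → ℂ) (hg : ContinuousOn g sq) (hinj : InjOn g sq)
    (α : I → ℂ) (hα : Continuous α) (α0 : α 0 = g (-1)) (α1 : α 1 = g 1)
    (hav : ∀ y : ℝ, |y| ≤ 1/2 → ∀ s, α s ≠ g ⟨0, y⟩) :
    ∃ D : Set ℂ, IsOpen D ∧ (∀ p ∈ D, p ∉ crv g α) ∧ IsClosed (crv g α ∪ D) ∧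
      g ⟨0, 1/2⟩ ∈ D ∧ g ⟨0, -1/2⟩ ∉ D := by
  have hsub : {z : ℂ | z.im = 0 ∧ |z.re| ≤ 1} ⊆ sq := fun z hz => ⟨hz.2, by rw [hz.1]; simp⟩
  have hsegc : IsCompact {z : ℂ | z.im = 0 ∧ |z.re| ≤ 1} := by
    have : {z : ℂ | z.im = 0 ∧ |z.re| ≤ 1} = (fun x : ℝ => (x : ℂ)) '' Icc (-1) 1 := by
      ext z
      constructor
      · rintro ⟨h1, h2⟩
        exact ⟨z.re, abs_le.1 h2, by apply Complex.ext <;> simp [h1]⟩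
      · rintro ⟨x, hx, rfl⟩
        exact ⟨by simp, by simpa using abs_le.2 hx⟩
    rw [this]
    exact isCompact_Icc.image Complex.continuous_ofReal
  have hCclosed : IsClosed (crv g α) :=
    ((isCompact_range hα).union (hsegc.image_of_continuousOn (hg.mono hsub))).isClosed
  have hgarc : ∀ k : ℝ, |k| ≤ 1 → Continuous (fun θ => g (arc k θ)) := fun k hk =>
    hg.comp_continuous (continuous_arc' k) (fun θ => arc_mem hk θ)
  let J : ℂ → ℂ := fun p => vlog (fun s => α s - p) - vlog (fun s => g (arc 0 s) - p)
  have hαC : ∀ p ∈ (crv g α)ᶜ, ∀ s, α s - p ≠ 0 := fun p hp s h =>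
    hp (Or.inl ⟨s, sub_eq_zero.1 h⟩)
  have hgC : ∀ p ∈ (crv g α)ᶜ, ∀ s, g (arc 0 s) - p ≠ 0 := fun p hp s h =>
    hp (Or.inr ⟨_, arc0_mem s, sub_eq_zero.1 h⟩)
  have hJc : ContinuousOn J (crv g α)ᶜ := by
    rw [continuousOn_iff_continuous_domRestrict]
    refine Continuous.sub ?_ ?_
    · exact vlog_cont (A := ↥(crv g α)ᶜ) (fun s p => α s - p) (by fun_prop)
        (fun s p => hαC p p.2 s)
    · have := hgarc 0 (by simp)
      exact vlog_cont (A := ↥(crv g α)ᶜ) (fun s p => g (arc 0 s) - p)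
        ((this.comp continuous_fst).sub (by fun_prop))
        (fun s p => hgC p p.2 s)
  have hJe : ∀ p ∈ (crv g α)ᶜ, Complex.exp (J p) = 1 := by
    intro p hp
    simp only [J]
    rw [Complex.exp_sub, exp_vlog _ (by fun_prop) (hαC p hp),
      exp_vlog (fun s => g (arc 0 s) - p) ((hgarc 0 (by simp)).sub continuous_const) (hgC p hp)]
    simp only [arc_zero, arc_one, ← α0, ← α1]
    exact div_self (div_ne_zero (hαC p hp 1) (hαC p hp 0))
  have hiy : ∀ y : ℝ, |y| ≤ 1/2 → y ≠ 0 → g ⟨0, y⟩ ∈ (crv g α)ᶜ := by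
    rintro y hy hy0 (⟨s, hs⟩ | ⟨z, hz, hzy⟩)
    · exact hav y hy s hs
    · have := hinj (hsub hz) (iy_mem hy) hzy
      rw [this] at hz
      exact hy0 hz.1
  -- the jump
  have hABc : ∀ k : ℝ, |k| = 1 → ∀ y z : Icc (-(1/2) : ℝ) (1/2),
      vlog (fun s => α s - g ⟨0, y⟩) - vlog (fun s => g (arc k s) - g ⟨0, y⟩) =
      vlog (fun s => α s - g ⟨0, z⟩) - vlog (fun s => g (arc k s) - g ⟨0, z⟩) := by
    intro k hk y z
    have hgi : Continuous (fun y : Icc (-(1/2) : ℝ) (1/2) => g ⟨0, y⟩) :=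
      hg.comp_continuous (continuous_mk' (by fun_prop) (by fun_prop))
        (fun y => iy_mem (abs_le.2 y.2))
    have : PreconnectedSpace (Icc (-(1/2) : ℝ) (1/2)) :=
      isPreconnected_iff_preconnectedSpace.1 isPreconnected_Icc
    refine vlog_diff_const (A := Icc (-(1/2) : ℝ) (1/2)) (fun s y => α s - g ⟨0, y⟩)
      (fun s y => g (arc k s) - g ⟨0, y⟩)
      ((hα.comp continuous_fst).sub (hgi.comp continuous_snd)) ?_
      (((hgarc k hk.le).comp continuous_fst).sub (hgi.comp continuous_snd)) ?_
      (fun y => by simp [α0]) (fun y => by simp [α1]) y z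
    · intro s y
      exact sub_ne_zero.2 (hav y (abs_le.2 y.2) s)
    · intro s y h
      exact arc_ne_iy' s hk (abs_le.2 y.2)
        (hinj (arc_mem hk.le s) (iy_mem (abs_le.2 y.2)) (sub_eq_zero.1 h))
  have hSB : ∀ k y : ℝ, |k| = 1 → |y| ≤ 1/2 → ((k = 1 ∧ y < 0) ∨ (k = -1 ∧ 0 < y)) →
      vlog (fun s => g (arc 0 s) - g ⟨0, y⟩) = vlog (fun s => g (arc k s) - g ⟨0, y⟩) := by
    intro k y hk hy hky
    have hb : ∀ t : I, |k * (t : ℝ)| ≤ 1 := fun t => by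
      rw [abs_mul, hk, one_mul, abs_of_nonneg t.2.1]; exact t.2.2
    have hk2 : Continuous (fun p : I × I => g (arc (k * p.2) p.1)) := by
      refine hg.comp_continuous ?_ (fun p => arc_mem (hb p.2) p.1)
      exact continuous_mk' (by fun_prop) (by fun_prop)
    have := vlog_const (A := I) (fun s t => g (arc (k * t) s) - g ⟨0, y⟩)
      (hk2.sub continuous_const) ?_
      (g (-1) - g ⟨0, y⟩) (g 1 - g ⟨0, y⟩) (fun t => by simp) (fun t => by simp) 0 1
    · simpa using this
    · intro s t h
      have e := hinj (arc_mem (hb t) s) (iy_mem hy) (sub_eq_zero.1 h)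
      refine arc_ne_iy s ?_ e
      rcases hky with ⟨h1, h2⟩ | ⟨h1, h2⟩
      · left; exact ⟨by rw [h1, one_mul]; exact t.2.1, h2⟩
      · right; exact ⟨by rw [h1]; linarith [t.2.1], h2⟩
  have hjump : J (g ⟨0, -1/2⟩) ≠ J (g ⟨0, 1/2⟩) := by
    simp only [J]
    rw [hSB 1 (-1/2) (by simp) (by rw [abs_le]; constructor <;> norm_num) (Or.inl ⟨rfl, by norm_num⟩),
      hSB (-1) (1/2) (by simp) (by rw [abs_le]; constructor <;> norm_num) (Or.inr ⟨rfl, by norm_num⟩)]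
    have a1 := hABc 1 (by simp) ⟨-1/2, by constructor <;> norm_num⟩ ⟨0, by constructor <;> norm_num⟩
    have a2 := hABc (-1) (by simp) ⟨1/2, by constructor <;> norm_num⟩ ⟨0, by constructor <;> norm_num⟩
    simp only at a1 a2
    rw [a1, a2]
    intro h
    exact borsuk g hg hinj (sub_right_injective h)
  have hop : ∀ s : Set ℂ, IsOpen s → IsOpen ((crv g α)ᶜ ∩ J ⁻¹' s) := fun s hs =>
    hJc.isOpen_inter_preimage hCclosed.isOpen_compl hs
  set c := J (g ⟨0, 1/2⟩) with hc
  have hplus := hiy (1/2) (by rw [abs_le]; constructor <;> norm_num) (by norm_num)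
  refine ⟨(crv g α)ᶜ ∩ J ⁻¹' {c}, ?_, fun p hp => hp.1, ?_, ⟨hplus, rfl⟩, fun h => hjump h.2⟩
  · have : (crv g α)ᶜ ∩ J ⁻¹' {c} = (crv g α)ᶜ ∩ J ⁻¹' (Metric.ball c 1) := by
      ext p
      refine and_congr_right fun hp => ⟨fun h => ?_, fun h => ?_⟩
      · simp only [mem_preimage, mem_singleton_iff] at h
        simp [h]
      · rw [mem_preimage, mem_ball_iff_norm] at h
        exact sub_eq_zero.1 (eq_zero_of_exp (by
          rw [Complex.exp_sub, hJe p hp, hJe _ hplus]; simp) h)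
    rw [this]
    exact hop _ Metric.isOpen_ball
  · rw [← isOpen_compl_iff]
    have : (crv g α ∪ (crv g α)ᶜ ∩ J ⁻¹' {c})ᶜ = (crv g α)ᶜ ∩ J ⁻¹' {c}ᶜ := by
      ext p; simp only [mem_compl_iff, mem_union, mem_inter_iff, mem_preimage]; tauto
    rw [this]
    exact hop _ isOpen_compl_singleton

end PlaneAux

namespace FlowAux
open PlaneAux unitInterval

variable {E : Type*} [TopologicalSpace E]

/-- The standing assumptions on the flow. -/
structure Fl (M : Set E) (ξ : ℝ → E → E) : Prop where
  maps : ∀ t : ℝ, MapsTo (ξ t) M M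
  zero : ∀ x ∈ M, ξ 0 x = x
  add : ∀ t s : ℝ, ∀ x ∈ M, ξ (t + s) x = ξ t (ξ s x)
  cont : ContinuousOn (fun p : ℝ × E => ξ p.1 p.2) ((univ : Set ℝ) ×ˢ M)

lemma Fl.cont_t {M : Set E} {ξ : ℝ → E → E} (hf : Fl M ξ) {x : E} (hx : x ∈ M) :
    Continuous (fun t => ξ t x) := by
  refine hf.cont.comp_continuous (f := fun t : ℝ => (t, x)) (by fun_prop) (fun t => ⟨mem_univ _, hx⟩)

lemma Fl.neg {M : Set E} {ξ : ℝ → E → E} (hf : Fl M ξ) {x y : E} (hx : x ∈ M) {t : ℝ}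
    (h : ξ t x = y) : ξ (-t) y = x := by
  rw [← h, ← hf.add _ _ x hx, neg_add_cancel, hf.zero x hx]

/-- The uniqueness part of the section property. -/
def Uniq (ξ : ℝ → E → E) (ε : ℝ) (T : Set E) : Prop :=
  ∀ t ∈ Icc (-ε) ε, ∀ t' ∈ Icc (-ε) ε, ∀ q ∈ T, ∀ q' ∈ T, ξ t q = ξ t' q' → t = t' ∧ q = q'

lemma gap {M : Set E} {ξ : ℝ → E → E} (hf : Fl M ξ) {ε : ℝ} {T : Set E} (hTM : T ⊆ M)
    (hu : Uniq ξ ε T) {q : E} (hq : q ∈ T) {t : ℝ} (ht : ξ t q ∈ T) (hte : |t| ≤ 2 * ε) :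
    t = 0 := by
  obtain ⟨h1, h2⟩ := abs_le.1 hte
  have := (hu (t/2) ⟨by linarith, by linarith⟩ (-(t/2)) ⟨by linarith, by linarith⟩ q hq _ ht (by
    rw [← hf.add _ _ q (hTM hq)]; congr 1; ring)).1
  linarith

set_option maxHeartbeats 2000000 in
lemma first_return {M : Set E} {ξ : ℝ → E → E} (hf : Fl M ξ) {ε : ℝ} (hε : 0 < ε) {T : Set E}
    (hTM : T ⊆ M) (hu : Uniq ξ ε T)
    {h : ℝ → E} (hh : ContinuousOn h (Icc (-1 : ℝ) 1)) (hhi : InjOn h (Icc (-1 : ℝ) 1))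
    (hhT : h '' Icc (-1 : ℝ) 1 = T) {pr : E → ℂ} (hpr : Continuous pr) (hpi : InjOn pr M)
    {a : E} (ha : a ∈ T) {ℓ : ℝ} (hℓ : 0 < ℓ) (hb : ξ ℓ a ∈ T) (hab : ξ ℓ a ≠ a)
    (hno : ∀ t ∈ Ioo 0 ℓ, ξ t a ∉ T) :
    ∃ N Q : Set ℂ, IsOpen N ∧ IsClosed Q ∧ N ⊆ Q ∧
      (∀ k ∈ M, pr k ∈ Q → ∀ t, ℓ < t → pr (ξ t k) ∈ N) ∧
      pr (ξ (ε / 2) (ξ ℓ a)) ∈ Q ∧ pr (ξ (-(ε / 2)) a) ∉ Q := by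
  have haM := hTM ha
  have hcross : ∀ t, -ε ≤ t → t ≤ ℓ + ε → ξ t a ∈ T → t = 0 ∨ t = ℓ := by
    intro t h1 h2 h3
    rcases le_or_gt t 0 with h0 | h0
    · left
      exact gap hf hTM hu ha h3 (abs_le.2 ⟨by linarith, by linarith⟩)
    rcases lt_or_ge t ℓ with h4 | h4
    · exact absurd h3 (hno t ⟨h0, h4⟩)
    · right
      have : ξ (t - ℓ) (ξ ℓ a) ∈ T := by rw [← hf.add _ _ a haM, sub_add_cancel]; exact h3
      have := gap hf hTM hu hb this (abs_le.2 ⟨by linarith, by linarith⟩)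
      linarith
  obtain ⟨sa, hsa, hsa'⟩ := hhT.symm ▸ ha
  obtain ⟨sb, hsb, hsb'⟩ := hhT.symm ▸ hb
  have hsab : sa ≠ sb := by rintro rfl; exact hab (hsb'.symm.trans hsa')
  let par : ℝ → ℝ := fun x => (sa + sb) / 2 + (sb - sa) / 2 * x
  have hpar : ∀ x, |x| ≤ 1 → par x ∈ Icc (-1 : ℝ) 1 := by
    intro x hx
    obtain ⟨h1, h2⟩ := abs_le.1 hx
    obtain ⟨h3, h4⟩ := hsa
    obtain ⟨h5, h6⟩ := hsb
    simp only [par]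
    constructor <;> nlinarith
  have hpari : ∀ x y, par x = par y → x = y := by
    intro x y hxy
    simp only [par] at hxy
    have : (sb - sa) / 2 * (x - y) = 0 := by linarith
    rcases mul_eq_zero.1 this with h | h
    · exact absurd (by linarith) hsab
    · linarith
  have hparm : par (-1) = sa := by simp only [par]; ring
  have hparp : par 1 = sb := by simp only [par]; ring
  have hhp : ∀ x, |x| ≤ 1 → h (par x) ∈ T := fun x hx => hhT ▸ mem_image_of_mem h (hpar x hx)
  have hhpi : ∀ x y, |x| ≤ 1 → |y| ≤ 1 → h (par x) = h (par y) → x = y := fun x y hx hy e =>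
    hpari x y (hhi (hpar x hx) (hpar y hy) e)
  let pt : ℂ → E := fun z => ξ (ε * z.im) (h (par z.re))
  have hptM : ∀ z ∈ sq, pt z ∈ M := fun z hz => hf.maps _ (hTM (hhp _ hz.1))
  have hεm : ∀ y : ℝ, |y| ≤ 1 → ε * y ∈ Icc (-ε) ε := by
    intro y hy
    obtain ⟨h1, h2⟩ := abs_le.1 hy
    constructor <;> nlinarith
  have hptc : ContinuousOn pt sq := by
    have h1 : ContinuousOn (fun z : ℂ => h (par z.re)) sq := by
      refine hh.comp (f := fun z : ℂ => par z.re) ?_ (fun z hz => hpar _ hz.1)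
      apply Continuous.continuousOn
      simp only [par]; fun_prop
    have h2 : ContinuousOn (fun z : ℂ => (ε * z.im, h (par z.re))) sq := by
      refine ContinuousOn.prodMk ?_ h1
      fun_prop
    exact hf.cont.comp h2 (fun z hz => ⟨mem_univ _, hTM (hhp _ hz.1)⟩)
  have hpti : InjOn pt sq := by
    intro z hz w hw hzw
    obtain ⟨h1, h2⟩ := hu _ (hεm _ hz.2) _ (hεm _ hw.2) _ (hhp _ hz.1) _ (hhp _ hw.1) hzw
    exact Complex.ext (hhpi _ _ hz.1 hw.1 h2) (mul_left_cancel₀ hε.ne' h1)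
  let g : ℂ → ℂ := fun z => pr (pt z)
  have hgc : ContinuousOn g sq := hpr.comp_continuousOn hptc
  have hgi : InjOn g sq := fun z hz w hw hzw => hpti hz hw (hpi (hptM z hz) (hptM w hw) hzw)
  let α : I → ℂ := fun s => pr (ξ (ℓ * s) a)
  have hαc : Continuous α := hpr.comp ((hf.cont_t haM).comp (by fun_prop))
  -- the curve inside `M`
  let CE : Set E := {k | (∃ t ∈ Icc 0 ℓ, k = ξ t a) ∨ ∃ x, |x| ≤ 1 ∧ k = h (par x)}
  have hCE : ∀ k ∈ M, pr k ∈ crv g α → k ∈ CE := by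
    rintro k hk (⟨s, hs⟩ | ⟨z, hz, hzk⟩)
    · left
      refine ⟨ℓ * s, ⟨mul_nonneg hℓ.le s.2.1, by nlinarith [s.2.2]⟩, ?_⟩
      exact (hpi (hf.maps _ haM) hk hs).symm
    · right
      refine ⟨z.re, hz.2, ?_⟩
      have := hpi (hptM z ⟨hz.2, by rw [hz.1]; simp⟩) hk hzk
      rw [← this]
      simp only [pt, hz.1, mul_zero]
      rw [hf.zero _ (hTM (hhp _ hz.2))]
  have hCE' : ∀ k ∈ CE, pr k ∈ crv g α := by
    rintro k (⟨t, ht, rfl⟩ | ⟨x, hx, rfl⟩)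
    · left
      refine ⟨⟨t / ℓ, div_nonneg ht.1 hℓ.le, (div_le_one hℓ).2 ht.2⟩, ?_⟩
      simp only [α]
      rw [mul_div_cancel₀ _ hℓ.ne']
    · right
      refine ⟨⟨x, 0⟩, ⟨rfl, hx⟩, ?_⟩
      simp only [g, pt, mul_zero]
      rw [hf.zero _ (hTM (hhp _ hx))]
  have hbox : ∀ z ∈ sq, z.im ≠ 0 → pt z ∈ CE → (0 < z.im ∧ z.re = -1) ∨ (z.im < 0 ∧ z.re = 1) := by
    rintro z hz hz0 (⟨t, ht, he⟩ | ⟨x, hx, he⟩)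
    · have hm := hεm _ hz.2
      have h1 : ξ (t - ε * z.im) a = h (par z.re) := by
        rw [sub_eq_neg_add, hf.add _ _ a haM, ← he]
        exact hf.neg (hTM (hhp _ hz.1)) rfl
      have h2 := hcross (t - ε * z.im) (by linarith [hm.2, ht.1]) (by linarith [hm.1, ht.2])
        (h1 ▸ hhp _ hz.1)
      rcases h2 with h2 | h2
      · left
        rw [h2, hf.zero a haM, ← hsa', ← hparm] at h1
        refine ⟨?_, (hhpi _ _ (by simp) hz.1 h1).symm⟩
        have : 0 ≤ ε * z.im := by linarith [ht.1]
        have := nonneg_of_mul_nonneg_right this hε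
        exact lt_of_le_of_ne this hz0.symm
      · right
        rw [h2, ← hsb', ← hparp] at h1
        refine ⟨?_, (hhpi _ _ (by simp) hz.1 h1).symm⟩
        have : 0 ≤ ε * (-z.im) := by linarith [ht.2]
        have := nonneg_of_mul_nonneg_right this hε
        exact lt_of_le_of_ne (by linarith) hz0
    · exfalso
      have : ξ (ε * z.im) (h (par z.re)) = ξ 0 (h (par x)) := by
        rw [hf.zero _ (hTM (hhp _ hx))]; exact he
      have := (hu _ (hεm _ hz.2) 0 ⟨by linarith, by linarith⟩ _ (hhp _ hz.1) _ (hhp _ hx) this).1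
      exact hz0 ((mul_eq_zero.1 this).resolve_left hε.ne')
  obtain ⟨D, hDo, hDC, hDcl, hDp, hDm⟩ := planar_region g hgc hgi α hαc
    (by simp only [α, g, pt]; simp [hparm, hsa', hf.zero a haM])
    (by simp only [α, g, pt]; simp [hparp, hsb', hf.zero _ (hTM hb)])
    (by
      intro y hy s e
      have hz : (⟨0, y⟩ : ℂ) ∈ sq := iy_mem hy
      have e2 : ξ (ℓ * s) a = pt ⟨0, y⟩ := hpi (hf.maps _ haM) (hptM _ hz) e
      have hls : ℓ * (s : ℝ) ∈ Icc 0 ℓ := ⟨mul_nonneg hℓ.le s.2.1, by nlinarith [s.2.2]⟩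
      rcases eq_or_ne y 0 with rfl | hy0
      · simp only [pt, mul_zero] at e2
        rw [hf.zero _ (hTM (hhp _ hz.1))] at e2
        have h2 := hcross (ℓ * s) (by linarith [hls.1]) (by linarith [hls.2]) (e2 ▸ hhp _ hz.1)
        rcases h2 with h2 | h2
        · rw [h2, hf.zero a haM, ← hsa', ← hparm] at e2
          have := hhpi _ _ (by simp) (by simp) e2
          norm_num at this
        · rw [h2, ← hsb', ← hparp] at e2
          have := hhpi _ _ (by simp) (by simp) e2
          norm_num at this
      · have := hbox _ hz hy0 (Or.inl ⟨_, hls, e2.symm⟩)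
        norm_num at this)
  -- clopen
  have hclopen : ∀ S : Set ℂ, IsPreconnected S → (∀ p ∈ S, p ∉ crv g α) → (S ∩ D).Nonempty →
      S ⊆ D := by
    intro S hS hSC hSD
    refine hS.subset_left_of_subset_union hDo hDcl.isOpen_compl ?_ ?_ hSD
    · rw [Set.disjoint_left]; intro p hp hp'; exact hp' (Or.inr hp)
    · intro p hp
      by_cases hpD : p ∈ D
      · exact Or.inl hpD
      · exact Or.inr (fun h' => h'.elim (hSC p hp) hpD)
  have hsqconv : Convex ℝ sq := by
    have : sq = (Complex.reLm ⁻¹' Icc (-1) 1) ∩ (Complex.imLm ⁻¹' Icc (-1) 1) := by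
      ext z; simp [PlaneAux.sq, abs_le]
    rw [this]
    exact ((convex_Icc _ _).linear_preimage _).inter ((convex_Icc _ _).linear_preimage _)
  have hUp : ∀ z ∈ sq, 0 < z.im → -1 < z.re → g z ∈ D := by
    have hconv : Convex ℝ (sq ∩ (Complex.imLm ⁻¹' Ioi 0 ∩ Complex.reLm ⁻¹' Ioi (-1))) :=
      hsqconv.inter (((convex_Ioi _).linear_preimage _).inter ((convex_Ioi _).linear_preimage _))
    have := hclopen (g '' (sq ∩ (Complex.imLm ⁻¹' Ioi 0 ∩ Complex.reLm ⁻¹' Ioi (-1))))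
      (hconv.isPreconnected.image g (hgc.mono inter_subset_left)) ?_
      ⟨_, mem_image_of_mem g ⟨iy_mem (y := 1/2) (by rw [abs_le]; constructor <;> norm_num),
        by simp, by simp⟩, hDp⟩
    · intro z hz h1 h2
      exact this (mem_image_of_mem g ⟨hz, h1, h2⟩)
    · rintro _ ⟨z, ⟨hz, h1, h2⟩, rfl⟩ hc
      have h1' : 0 < z.im := h1
      have h2' : -1 < z.re := h2
      rcases hbox z hz h1'.ne' (hCE _ (hptM z hz) hc) with h3 | h3
      · linarith [h3.2]
      · linarith [h3.1]
  have hLoC : ∀ z ∈ sq, z.im < 0 → z.re < 1 → g z ∉ crv g α := by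
    intro z hz h1 h2 hc
    rcases hbox z hz h1.ne (hCE _ (hptM z hz) hc) with h3 | h3
    · linarith [h3.1]
    · linarith [h3.2]
  have hLo : ∀ z ∈ sq, z.im < 0 → z.re < 1 → g z ∉ D := by
    intro z hz h1 h2 hc
    have hconv : Convex ℝ (sq ∩ (Complex.imLm ⁻¹' Iio 0 ∩ Complex.reLm ⁻¹' Iio 1)) :=
      hsqconv.inter (((convex_Iio _).linear_preimage _).inter ((convex_Iio _).linear_preimage _))
    have := hclopen (g '' (sq ∩ (Complex.imLm ⁻¹' Iio 0 ∩ Complex.reLm ⁻¹' Iio 1)))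
      (hconv.isPreconnected.image g (hgc.mono inter_subset_left)) ?_
      ⟨_, mem_image_of_mem g ⟨hz, h1, h2⟩, hc⟩
    · exact hDm (this (mem_image_of_mem g ⟨iy_mem (by rw [abs_le]; constructor <;> norm_num),
        by norm_num, by simp⟩))
    · rintro _ ⟨z, ⟨hz, h1, h2⟩, rfl⟩
      exact hLoC z hz h1 h2
  -- box points in terms of the flow
  have hUp' : ∀ x, |x| ≤ 1 → x ≠ -1 → ∀ s, 0 < s → s ≤ ε → pr (ξ s (h (par x))) ∈ D := by
    intro x hx hx1 s hs hs'
    have := hUp ⟨x, s / ε⟩ ⟨hx, by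
      simp only; rw [abs_of_pos (by positivity), div_le_one hε]; exact hs'⟩
      (by simp only; positivity) (lt_of_le_of_ne (abs_le.1 hx).1 hx1.symm)
    simpa only [g, pt, mul_div_cancel₀ _ hε.ne'] using this
  have hLo' : ∀ x, |x| ≤ 1 → x ≠ 1 → ∀ s, 0 < s → s ≤ ε →
      pr (ξ (-s) (h (par x))) ∉ D ∧ pr (ξ (-s) (h (par x))) ∉ crv g α := by
    intro x hx hx1 s hs hs'
    have hzsq : (⟨x, -s / ε⟩ : ℂ) ∈ sq := ⟨hx, by
      simp only; rw [neg_div, abs_neg, abs_of_pos (by positivity), div_le_one hε]; exact hs'⟩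
    have him : (⟨x, -s / ε⟩ : ℂ).im < 0 := by
      simp only; rw [neg_div]; simp only [Left.neg_neg_iff]; positivity
    have hre : (⟨x, -s / ε⟩ : ℂ).re < 1 := lt_of_le_of_ne (abs_le.1 hx).2 hx1
    have h1 := hLo _ hzsq him hre
    have h2 := hLoC _ hzsq him hre
    simp only [g, pt, mul_div_cancel₀ _ hε.ne'] at h1 h2
    exact ⟨h1, h2⟩
  have hCcl : IsClosed (crv g α) := by
    have : crv g α = (crv g α ∪ D) ∩ Dᶜ := by
      ext p
      constructor
      · intro hp; exact ⟨Or.inl hp, fun hd => hDC p hd hp⟩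
      · rintro ⟨h1 | h1, h2⟩
        · exact h1
        · exact absurd h1 h2
    rw [this]; exact hDcl.inter hDo.isClosed_compl
  -- forward invariance of D
  have hinv : ∀ k ∈ M, pr k ∈ D → ∀ t, 0 ≤ t → pr (ξ t k) ∈ D := by
    intro k hk hkD t ht
    have hcont : Continuous (fun s => pr (ξ s k)) := hpr.comp (hf.cont_t hk)
    by_cases hex : ∃ s ∈ Icc 0 t, pr (ξ s k) ∈ crv g α
    · exfalso
      have hcomp : IsCompact (Icc 0 t ∩ (fun s => pr (ξ s k)) ⁻¹' crv g α) :=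
        isCompact_Icc.inter_right (hCcl.preimage hcont)
      obtain ⟨s₀, hs₀, hmin⟩ := hcomp.exists_isLeast ⟨hex.choose, hex.choose_spec.1, hex.choose_spec.2⟩
      have hs₀pos : 0 < s₀ := by
        rcases hs₀.1.1.eq_or_lt with h0 | h0
        · exfalso
          have := hs₀.2
          rw [mem_preimage, ← h0, hf.zero k hk] at this
          exact hDC _ hkD this
        · exact h0
      have hbefore : ∀ s, 0 ≤ s → s < s₀ → pr (ξ s k) ∈ D := by
        intro s hs hss
        have := hclopen ((fun s => pr (ξ s k)) '' Icc 0 s)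
          (isPreconnected_Icc.image _ hcont.continuousOn) ?_
          ⟨_, mem_image_of_mem _ ⟨le_refl 0, hs⟩, by simp only [hf.zero k hk]; exact hkD⟩
        · exact this (mem_image_of_mem _ ⟨hs, le_refl s⟩)
        · rintro _ ⟨u, hu, rfl⟩ huC
          have := hmin ⟨⟨hu.1, by linarith [hu.2, hs₀.1.2]⟩, huC⟩
          linarith [hu.2]
      -- the hitting point
      have hbk : ∀ s, ξ (-s) (ξ s₀ k) = ξ (s₀ - s) k := fun s => by
        rw [← hf.add _ _ k hk]; congr 1; ring
      have hT1 : ∀ x, |x| ≤ 1 → x ≠ 1 → ξ s₀ k ≠ h (par x) := by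
        intro x hx hx1 e
        have hs1 : 0 < min ε s₀ := lt_min hε hs₀pos
        have h1 := (hLo' x hx hx1 (min ε s₀) hs1 (min_le_left _ _)).1
        rw [← e, hbk] at h1
        exact h1 (hbefore _ (by linarith [min_le_right ε s₀]) (by linarith))
      have hA1 : ∀ u ∈ Icc 0 ℓ, ξ s₀ k ≠ ξ u a := by
        intro u hu' e
        rcases hu'.1.eq_or_lt with h0 | h0
        · rw [← h0, hf.zero a haM, ← hsa', ← hparm] at e
          exact hT1 (-1) (by simp) (by norm_num) e
        · have hs1 : 0 < min u s₀ := lt_min h0 hs₀pos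
          have h1 := hbefore (s₀ - min u s₀) (by linarith [min_le_right u s₀]) (by linarith)
          rw [← hbk, e, ← hf.add _ _ a haM] at h1
          refine hDC _ h1 (hCE' _ (Or.inl ⟨_, ⟨?_, ?_⟩, rfl⟩))
          · linarith [min_le_left u s₀]
          · linarith [hu'.2]
      rcases hCE _ (hf.maps _ hk) hs₀.2 with ⟨u, hu', e⟩ | ⟨x, hx, e⟩
      · exact hA1 u hu' e
      · rcases eq_or_ne x 1 with rfl | hx1
        · rw [hparp, hsb'] at e
          exact hA1 ℓ ⟨hℓ.le, le_refl _⟩ e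
        · exact hT1 x hx hx1 e
    · have := hclopen ((fun s => pr (ξ s k)) '' Icc 0 t)
          (isPreconnected_Icc.image _ hcont.continuousOn) ?_
          ⟨_, mem_image_of_mem _ ⟨le_refl 0, ht⟩, by simp only [hf.zero k hk]; exact hkD⟩
      · exact this (mem_image_of_mem _ ⟨ht, le_refl t⟩)
      · rintro _ ⟨u, hu', rfl⟩ huC
        exact hex ⟨u, hu', huC⟩
  -- leaving from T
  have hfromT : ∀ x, |x| ≤ 1 → x ≠ -1 → ∀ s, 0 < s → pr (ξ s (h (par x))) ∈ D := by
    intro x hx hx1 s hs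
    have hm : 0 < min s ε := lt_min hs hε
    have h1 := hUp' x hx hx1 (min s ε) hm (min_le_right _ _)
    have h2 := hinv _ (hf.maps _ (hTM (hhp x hx))) h1 (s - min s ε) (by linarith [min_le_left s ε])
    rwa [← hf.add _ _ _ (hTM (hhp x hx)), sub_add_cancel] at h2
  have hfromb : ∀ s, 0 < s → pr (ξ s (ξ ℓ a)) ∈ D := by
    intro s hs
    have := hfromT 1 (by simp) (by norm_num) s hs
    rwa [hparp, hsb'] at this
  refine ⟨D, crv g α ∪ D, hDo, hDcl, subset_union_right, ?_, Or.inr (hfromb _ (by positivity)), ?_⟩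
  · rintro k hk (hC | hD) t ht
    · have harc : ∀ u ∈ Icc 0 ℓ, k = ξ u a → pr (ξ t k) ∈ D := by
        intro u hu' e
        have := hfromb (t + u - ℓ) (by linarith [hu'.1])
        rw [← hf.add _ _ a haM] at this
        rw [e, ← hf.add _ _ a haM]
        convert this using 3
        ring
      rcases hCE k hk hC with ⟨u, hu', e⟩ | ⟨x, hx, e⟩
      · exact harc u hu' e
      · rcases eq_or_ne x (-1) with rfl | hx1
        · rw [hparm, hsa'] at e
          exact harc 0 ⟨le_refl _, hℓ.le⟩ (by rw [hf.zero a haM]; exact e)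
        · rw [e]; exact hfromT x hx hx1 t (by linarith)
    · exact hinv k hk hD t (by linarith)
  · have := hLo' (-1) (by simp) (by norm_num) (ε/2) (by positivity) (by linarith)
    rw [hparm, hsa'] at this
    rintro (h1 | h1)
    · exact this.2 h1
    · exact this.1 h1

end FlowAux

namespace DynAux

section Proj
variable {E : Type*} [NormedAddCommGroup E] [NormedSpace ℝ E]

lemma exists_proj (Ep Em : Submodule ℝ E) (hc : IsClosed (Ep : Set E)) (h : IsCompl Ep Em)
    [FiniteDimensional ℝ ↥Em] (h2 : Module.finrank ℝ ↥Em = 2) :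
    ∃ pr : E → ℂ, Continuous pr ∧ ∀ a b, pr a = pr b → a - b ∈ Ep := by
  have e1 : (E ⧸ Ep) ≃ₗ[ℝ] Em := Submodule.quotientEquivOfIsCompl Ep Em h
  have e2 : Em ≃ₗ[ℝ] ℂ := LinearEquiv.ofFinrankEq _ _ (by rw [h2, Complex.finrank_real_complex])
  have hq : IsClosed (Ep : Set E) := hc
  have : FiniteDimensional ℝ (E ⧸ Ep) := LinearEquiv.finiteDimensional e1.symm
  have : T2Space (E ⧸ Ep) := by
    have : IsClosed (Ep.toAddSubgroup : Set E) := hc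
    have : T3Space (E ⧸ Ep) := inferInstance
    infer_instance
  refine ⟨fun x => (e1.trans e2) (Ep.mkQ x), ?_, ?_⟩
  · have h1 : Continuous (Ep.mkQ) := continuous_quot_mk
    have h3 : Continuous ((e1.trans e2).toLinearMap) := LinearMap.continuous_of_finiteDimensional _
    exact h3.comp h1
  · intro a b hab
    have := (e1.trans e2).injective hab
    rw [Submodule.mkQ_apply, Submodule.mkQ_apply, Submodule.Quotient.eq] at this
    exact this

end Proj

section Inj
variable {E : Type*} [NormedAddCommGroup E] [NormedSpace ℝ E]
  {H : Type*} [NormedAddCommGroup H] [InnerProductSpace ℝ H]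

lemma neg_of_amenable (ι : E →L[ℝ] H) (hι : Function.Injective ι)
    (φ : Semiflow E) (P : E →L[ℝ] E →L[ℝ] ℝ) (δ τV ν : ℝ) (hH3 : φ.IsH3 ι P δ τV ν)
    (hS : φ.IsSmoothing ι) {u₁ u₂ : ℝ → E} (h₁ : φ.IsAmenableTrajectory ι ν u₁)
    (h₂ : φ.IsAmenableTrajectory ι ν u₂) (hne : u₁ 0 ≠ u₂ 0) :
    P (u₁ 0 - u₂ 0) (u₁ 0 - u₂ 0) < 0 := by
  obtain ⟨hδ, hτV, hν, H3⟩ := hH3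
  obtain ⟨τ, C, hτ, hC, hSm⟩ := hS
  obtain ⟨⟨hc1, ht1⟩, hi1⟩ := h₁
  obtain ⟨⟨hc2, ht2⟩, hi2⟩ := h₂
  set g : ℝ → ℝ := fun s => Real.exp (2 * ν * s) * ‖ι (u₁ s) - ι (u₂ s)‖ ^ 2 with hg
  have hgc : Continuous g := by fun_prop
  have hg0 : ∀ s, 0 ≤ g s := fun s => by positivity
  have hgi : IntegrableOn g (Iic 0) := by
    refine Integrable.mono' ((hi1.add hi2).const_mul 2) hgc.aestronglyMeasurable (ae_of_all _ ?_)
    intro s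
    rw [Real.norm_of_nonneg (hg0 s)]
    simp only [Pi.add_apply, hg]
    have h1 := norm_sub_le (ι (u₁ s)) (ι (u₂ s))
    have h2 : ‖ι (u₁ s) - ι (u₂ s)‖ ^ 2 ≤ 2 * (‖ι (u₁ s)‖ ^ 2 + ‖ι (u₂ s)‖ ^ 2) := by
      nlinarith [sq_nonneg (‖ι (u₁ s)‖ - ‖ι (u₂ s)‖), norm_nonneg (ι (u₁ s) - ι (u₂ s)),
        norm_nonneg (ι (u₁ s)), norm_nonneg (ι (u₂ s))]
    have := mul_le_mul_of_nonneg_left h2 (Real.exp_pos (2 * ν * s)).le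
    linarith
  have hcpos : 0 < ∫ s in (-1 : ℝ)..0, g s := by
    refine intervalIntegral.integral_pos (by norm_num) hgc.continuousOn (fun s _ => hg0 s)
      ⟨0, by norm_num, ?_⟩
    have : ι (u₁ 0) - ι (u₂ 0) ≠ 0 := sub_ne_zero.2 (fun h => hne (hι h))
    have := norm_pos_iff.2 this
    simp only [hg]; positivity
  by_contra! hV
  set n0 := max τV 1
  set K := ‖P‖ * C ^ 2 * Real.exp (2 * ν * τ)
  have key : ∀ n, n0 ≤ n → δ * (∫ s in (-1 : ℝ)..0, g s) ≤ K * g (-n - τ) := by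
    intro n hn
    have hn1 : 1 ≤ n := (le_max_right _ _).trans hn
    have hn2 : τV ≤ n := (le_max_left _ _).trans hn
    have h := H3 (u₁ (-n)) (u₂ (-n)) 0 n le_rfl (by linarith) (by linarith)
    have e1 : ∀ s, 0 ≤ s → φ.toFun s (u₁ (-n)) = u₁ (s - n) := fun s hs => by
      rw [← ht1 s hs]; rfl
    have e2 : ∀ s, 0 ≤ s → φ.toFun s (u₂ (-n)) = u₂ (s - n) := fun s hs => by
      rw [← ht2 s hs]; rfl
    have hIntEq : (∫ s in (0:ℝ)..n, Real.exp (2 * ν * s) *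
        ‖ι (φ.toFun s (u₁ (-n))) - ι (φ.toFun s (u₂ (-n)))‖ ^ 2)
        = Real.exp (2 * ν * n) * ∫ s in (-n)..0, g s := by
      rw [← intervalIntegral.integral_const_mul]
      have := intervalIntegral.integral_comp_sub_right
        (a := 0) (b := n) (fun s => Real.exp (2 * ν * n) * g s) n
      rw [zero_sub, sub_self] at this
      rw [← this]
      refine intervalIntegral.integral_congr ?_
      intro s hs
      rw [uIcc_of_le (by linarith)] at hs
      simp only [hg]
      rw [e1 s hs.1, e2 s hs.1, ← mul_assoc, ← Real.exp_add]
      congr 2; ring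
    rw [hIntEq, e1 n (by linarith), e2 n (by linarith), e1 0 le_rfl, e2 0 le_rfl] at h
    simp only [sub_self, zero_sub, mul_zero, Real.exp_zero, one_mul] at h
    have hmono : (∫ s in (-1 : ℝ)..0, g s) ≤ ∫ s in (-n)..0, g s := by
      refine intervalIntegral.integral_mono_interval (by linarith) (by norm_num) le_rfl
        (ae_of_all _ hg0) (hgc.intervalIntegrable _ _)
    have hVn : P (u₁ (-n) - u₂ (-n)) (u₁ (-n) - u₂ (-n)) ≤
        ‖P‖ * C ^ 2 * ‖ι (u₁ (-n - τ)) - ι (u₂ (-n - τ))‖ ^ 2 := by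
      have s1 : ‖u₁ (-n) - u₂ (-n)‖ ≤ C * ‖ι (u₁ (-n - τ)) - ι (u₂ (-n - τ))‖ := by
        have := hSm (u₁ (-n - τ)) (u₂ (-n - τ))
        rw [← ht1 τ hτ, ← ht2 τ hτ] at this
        simpa using this
      have s2 := (le_abs_self _).trans (P.le_opNorm₂ (u₁ (-n) - u₂ (-n)) (u₁ (-n) - u₂ (-n)))
      have s3 : ‖u₁ (-n) - u₂ (-n)‖ * ‖u₁ (-n) - u₂ (-n)‖ ≤
        (C * ‖ι (u₁ (-n - τ)) - ι (u₂ (-n - τ))‖) * (C * ‖ι (u₁ (-n - τ)) - ι (u₂ (-n - τ))‖) :=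
        mul_le_mul s1 s1 (norm_nonneg _) (by positivity)
      have s4 := mul_le_mul_of_nonneg_left s3 (norm_nonneg P)
      calc _ ≤ _ := s2
        _ = _ := mul_assoc _ _ _
        _ ≤ _ := s4
        _ = _ := by ring
    have hexp := Real.exp_pos (2 * ν * n)
    have hK : K * g (-n - τ) * Real.exp (2 * ν * n) =
        ‖P‖ * C ^ 2 * ‖ι (u₁ (-n - τ)) - ι (u₂ (-n - τ))‖ ^ 2 := by
      have : Real.exp (2 * ν * τ) * Real.exp (2 * ν * (-n - τ)) * Real.exp (2 * ν * n) = 1 := by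
        rw [← Real.exp_add, ← Real.exp_add, ← Real.exp_zero]; congr 1; ring
      simp only [K, hg]
      linear_combination (‖P‖ * C ^ 2 * ‖ι (u₁ (-n - τ)) - ι (u₂ (-n - τ))‖ ^ 2) * this
    refine le_of_mul_le_mul_right ?_ hexp
    rw [hK]
    have q1 : 0 ≤ Real.exp (2 * ν * n) * P (u₁ 0 - u₂ 0) (u₁ 0 - u₂ 0) := by positivity
    have q2 := mul_le_mul_of_nonneg_left hmono (mul_nonneg hδ.le hexp.le)
    linarith
  have hconst : IntegrableOn (fun _ : ℝ => δ * (∫ s in (-1 : ℝ)..0, g s)) (Iic (-n0 - τ)) := by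
    have hle : -n0 - τ ≤ 0 := by
      have : (1 : ℝ) ≤ n0 := le_max_right _ _
      linarith
    have hgi' : IntegrableOn (fun s => K * g s) (Iic (-n0 - τ)) :=
      (hgi.mono_set (Iic_subset_Iic.2 hle)).const_mul K
    refine Integrable.mono' hgi' aestronglyMeasurable_const ?_
    refine (ae_restrict_iff' measurableSet_Iic).2 (ae_of_all _ ?_)
    intro s hs
    rw [Real.norm_of_nonneg (by positivity)]
    have := key (-s - τ) (by have := mem_Iic.1 hs; linarith)
    have e : -(-s - τ) - τ = s := by ring
    rwa [e] at this
  rw [integrableOn_const_iff] at hconst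
  rcases hconst with h | h
  · exact (mul_pos hδ hcpos).ne' (by simpa using h)
  · simp at h

end Inj

section Omega
variable {E : Type*} [NormedAddCommGroup E] [NormedSpace ℝ E]

lemma cont_map (φ : Semiflow E) {t : ℝ} (ht : 0 ≤ t) : Continuous (φ.toFun t) :=
  φ.continuousOn'.comp_continuous (f := fun x : E => (t, x)) (by fun_prop)
    (fun _ => ⟨ht, mem_univ _⟩)

lemma mem_omega (φ : Semiflow E) (w₀ k : E) :
    k ∈ φ.omegaLimit w₀ ↔ MapClusterPt k atTop (fun t => φ.toFun t w₀) := by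
  rw [mapClusterPt_iff_frequently]
  simp only [Semiflow.omegaLimit, mem_iInter, mem_closure_iff_nhds, frequently_atTop]
  constructor
  · intro h s hs a
    obtain ⟨y, hy, t, ht, rfl⟩ := h (max a 0) (mem_Ici.2 (le_max_right _ _)) s hs
    exact ⟨t, (le_max_left _ _).trans ht, hy⟩
  · intro h a _ s hs
    obtain ⟨t, ht, hy⟩ := h s hs a
    exact ⟨_, hy, t, ht, rfl⟩

lemma freq_omega {φ : Semiflow E} {w₀ k : E} (hk : k ∈ φ.omegaLimit w₀) {U : Set E}
    (hU : IsOpen U) (hkU : k ∈ U) : ∃ᶠ t in atTop, φ.toFun t w₀ ∈ U :=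
  mapClusterPt_iff_frequently.1 ((mem_omega _ _ _).1 hk) U (hU.mem_nhds hkU)

lemma exists_cpt {φ : Semiflow E} (hCOM : φ.IsCOM) {w₀ : E} (hb : IsBounded (φ.orbit w₀)) :
    ∃ c : Set E, IsCompact c ∧ ∀ᶠ t in atTop, φ.toFun t w₀ ∈ c := by
  obtain ⟨τ, hτ, h⟩ := hCOM
  refine ⟨_, h _ hb, eventually_atTop.2 ⟨τ, fun t ht => subset_closure ?_⟩⟩
  refine ⟨φ.toFun (t - τ) w₀, ⟨t - τ, by linarith, rfl⟩, ?_⟩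
  rw [← φ.map_add' _ _ hτ.le (by linarith)]
  congr 1; ring

lemma omega_compact {φ : Semiflow E} {w₀ : E} {c : Set E} (hc : IsCompact c)
    (hw : ∀ᶠ t in atTop, φ.toFun t w₀ ∈ c) : IsCompact (φ.omegaLimit w₀) := by
  refine hc.of_isClosed_subset (isClosed_biInter fun _ _ => isClosed_closure) ?_
  intro k hk
  by_contra hkc
  exact (freq_omega hk hc.isClosed.isOpen_compl hkc) (hw.mono fun t ht h => h ht)

lemma omega_attracts {φ : Semiflow E} {w₀ : E} {c : Set E} (hc : IsCompact c)
    (hw : ∀ᶠ t in atTop, φ.toFun t w₀ ∈ c) {U : Set E} (hU : IsOpen U)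
    (hKU : φ.omegaLimit w₀ ⊆ U) : ∀ᶠ t in atTop, φ.toFun t w₀ ∈ U := by
  by_contra hcon
  have hf : ∃ᶠ t in atTop, φ.toFun t w₀ ∈ c \ U := by
    refine (Filter.not_eventually.1 hcon).mp (hw.mono fun t ht h => ⟨ht, h⟩)
  obtain ⟨x, hx, hcl⟩ := (hc.diff hU).exists_mapClusterPt_of_frequently hf
  exact hx.2 (hKU ((mem_omega _ _ _).2 hcl))

lemma omega_fwd {φ : Semiflow E} {w₀ k : E} (hk : k ∈ φ.omegaLimit w₀) {t : ℝ} (ht : 0 ≤ t) :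
    φ.toFun t k ∈ φ.omegaLimit w₀ := by
  rw [mem_omega, mapClusterPt_iff_frequently]
  intro s hs
  have h1 := mapClusterPt_iff_frequently.1 ((mem_omega _ _ _).1 hk) _
    ((cont_map φ ht).continuousAt hs)
  rw [frequently_atTop] at h1 ⊢
  intro a
  obtain ⟨b, hb, hbs⟩ := h1 (max a 0)
  refine ⟨t + b, ?_, ?_⟩
  · have := (le_max_left _ _).trans hb
    linarith
  · rw [φ.map_add' _ _ ht ((le_max_right _ _).trans hb)]
    exact hbs

lemma omega_bwd {φ : Semiflow E} {w₀ k : E} {c : Set E} (hc : IsCompact c)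
    (hw : ∀ᶠ t in atTop, φ.toFun t w₀ ∈ c) (hk : k ∈ φ.omegaLimit w₀) {t : ℝ} (ht : 0 ≤ t) :
    ∃ k' ∈ φ.omegaLimit w₀, φ.toFun t k' = k := by
  obtain ⟨U, hU, hUk⟩ := mapClusterPt_iff_ultrafilter.1 ((mem_omega _ _ _).1 hk)
  have hsub : Tendsto (fun s : ℝ => s - t) U atTop :=
    (tendsto_atTop_add_const_right atTop (-t) tendsto_id).mono_left hU
  have hle : (↑(U.map (fun s => φ.toFun (s - t) w₀)) : Filter E) ≤ 𝓟 c := by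
    rw [Ultrafilter.coe_map, le_principal_iff]
    exact hsub.eventually hw
  obtain ⟨k', hk', hlim⟩ := hc.ultrafilter_le_nhds _ hle
  rw [Ultrafilter.coe_map] at hlim
  have hlim' : Tendsto (fun s => φ.toFun (s - t) w₀) U (𝓝 k') := hlim
  refine ⟨k', (mem_omega _ _ _).2 (mapClusterPt_iff_ultrafilter.2
    ⟨U.map (fun s => s - t), hsub, ?_⟩), ?_⟩
  · rw [Ultrafilter.coe_map]
    exact tendsto_map'_iff.2 hlim'
  · have h2 := ((cont_map φ ht).tendsto k').comp hlim'
    refine tendsto_nhds_unique h2 (hUk.congr' ?_)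
    filter_upwards [hU (eventually_ge_atTop t)] with s hs
    simp only [Function.comp]
    rw [← φ.map_add' _ _ ht (sub_nonneg.2 hs)]
    congr 1; ring

end Omega

section Amen
variable {E : Type*} [NormedAddCommGroup E] [NormedSpace ℝ E]
  {H : Type*} [NormedAddCommGroup H] [InnerProductSpace ℝ H]

lemma omega_amenable (ι : E →L[ℝ] H) {φ : Semiflow E} {ν : ℝ} (hν : 0 < ν) {w₀ k : E} {c : Set E}
    (hc : IsCompact c) (hw : ∀ᶠ t in atTop, φ.toFun t w₀ ∈ c) (hk : k ∈ φ.omegaLimit w₀) :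
    k ∈ φ.amenableSet ι ν := by
  choose! b hbK hb using fun x (hx : x ∈ φ.omegaLimit w₀) =>
    omega_bwd hc hw hx (zero_le_one (α := ℝ))
  set kk : ℕ → E := fun n => b^[n] k
  have hkkK : ∀ n, kk n ∈ φ.omegaLimit w₀ := by
    intro n
    induction n with
    | zero => exact hk
    | succ n ih => simp only [kk, Function.iterate_succ_apply']; exact hbK _ ih
  have hstep : ∀ n, φ.toFun 1 (kk (n + 1)) = kk n := by
    intro n
    have := hb _ (hkkK n)
    simp only [kk, Function.iterate_succ_apply'] at this ⊢
    exact this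
  have hsteps : ∀ m n : ℕ, φ.toFun m (kk (n + m)) = kk n := by
    intro m
    induction m with
    | zero => intro n; simpa using φ.map_zero' _
    | succ m ih =>
      intro n
      rw [Nat.cast_succ, φ.map_add' _ _ (Nat.cast_nonneg _) zero_le_one, ← add_assoc, hstep, ih]
  set u : ℝ → E := fun s => φ.toFun (s + ⌈-s⌉₊) (kk ⌈-s⌉₊) with hu
  have hceil : ∀ s : ℝ, 0 ≤ s + ⌈-s⌉₊ := fun s => by
    have := Nat.le_ceil (-s); linarith
  have hun : ∀ (s : ℝ) (n : ℕ), 0 ≤ s + n → u s = φ.toFun (s + n) (kk n) := by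
    intro s n hn
    have hle : ⌈-s⌉₊ ≤ n := Nat.ceil_le.2 (by linarith)
    obtain ⟨m, rfl⟩ := Nat.exists_eq_add_of_le hle
    have h1 := hsteps m ⌈-s⌉₊
    simp only [hu]
    rw [← h1, ← φ.map_add' _ _ (hceil s) (Nat.cast_nonneg _)]
    rw [Nat.cast_add, add_assoc]
  have huK : ∀ s, u s ∈ φ.omegaLimit w₀ := fun s => omega_fwd (hkkK _) (hceil s)
  have hucont : Continuous u := by
    rw [continuous_iff_continuousAt]
    intro s
    obtain ⟨n, hn⟩ := exists_nat_gt (-s)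
    have hn' : -(n : ℝ) < s := by linarith
    have h1 : ContinuousOn (fun s : ℝ => φ.toFun (s + n) (kk n)) (Ioi (-(n : ℝ))) := by
      refine φ.continuousOn'.comp (f := fun s : ℝ => (s + n, kk n)) (by fun_prop) ?_
      intro x hx
      refine ⟨?_, mem_univ _⟩
      have := mem_Ioi.1 hx
      simp only [mem_Ici]; linarith
    refine (h1.continuousAt (Ioi_mem_nhds hn')).congr ?_
    filter_upwards [Ioi_mem_nhds hn'] with x hx
    exact (hun x n (by have := mem_Ioi.1 hx; linarith)).symm
  refine ⟨u, ⟨⟨hucont, ?_⟩, ?_⟩, ?_⟩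
  · intro t ht s
    rw [hun (t + s) ⌈-s⌉₊ (by have := hceil s; linarith), add_assoc, φ.map_add' _ _ ht (hceil s)]
  · obtain ⟨R, hR⟩ := (omega_compact hc hw).isBounded.exists_norm_le
    have hexp : IntegrableOn (fun s : ℝ => Real.exp (2 * ν * s)) (Iic 0) :=
      integrableOn_exp_mul_Iic (by positivity) 0
    refine Integrable.mono' (hexp.mul_const ((‖ι‖ * R) ^ 2)) (by
      refine Continuous.aestronglyMeasurable ?_
      fun_prop) (ae_of_all _ ?_)
    intro s
    rw [Real.norm_of_nonneg (by positivity)]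
    have h1 : ‖ι (u s)‖ ≤ ‖ι‖ * R :=
      (ι.le_opNorm _).trans (mul_le_mul_of_nonneg_left (hR _ (huK s)) (norm_nonneg _))
    gcongr
  · have := hun 0 0 (by simp)
    rw [this]
    simpa [kk] using φ.map_zero' k

end Amen

section Trap
variable {E : Type*} [NormedAddCommGroup E] [NormedSpace ℝ E]

lemma trap {φ : Semiflow E} {w₀ : E} {c : Set E} (hc : IsCompact c)
    (hw : ∀ᶠ t in atTop, φ.toFun t w₀ ∈ c) {A B : Set E} (hA : IsCompact A) (hB : IsCompact B)
    (hKAB : φ.omegaLimit w₀ ⊆ A ∪ B) {τ : ℝ} (hτ : 0 < τ)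
    (hdis : ∀ t ∈ Icc τ (2 * τ), ∀ k ∈ A, φ.toFun t k ∉ B) {x z : E}
    (hx : x ∈ φ.omegaLimit w₀) (hxA : x ∈ A) (hz : z ∈ φ.omegaLimit w₀) (hzB : z ∈ B) : False := by
  set ψ : ℝ × E → E := fun p => φ.toFun (max p.1 0) p.2 with hψ
  have hψc : Continuous ψ := φ.continuousOn'.comp_continuous
    (f := fun p : ℝ × E => (max p.1 0, p.2)) (by fun_prop) (fun p => ⟨mem_Ici.2 (le_max_right _ _), mem_univ _⟩)
  have hψe : ∀ t x, 0 ≤ t → ψ (t, x) = φ.toFun t x := fun t x ht => by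
    simp only [hψ, max_eq_left ht]
  have hA' : IsCompact (ψ '' (Icc τ (2 * τ) ×ˢ A)) := (isCompact_Icc.prod hA).image hψc
  have hd : Disjoint (ψ '' (Icc τ (2 * τ) ×ˢ A)) B := by
    rw [Set.disjoint_left]
    rintro _ ⟨⟨t, k⟩, ⟨ht, hk⟩, rfl⟩ hB'
    rw [hψe t k (hτ.le.trans ht.1)] at hB'
    exact hdis t ht k hk hB'
  obtain ⟨G, R, hG, hR, hAG, hBR, hGR⟩ := SeparatedNhds.of_isCompact_isCompact hA' hB hd
  obtain ⟨u, O, -, hO, hu, hAO, huO⟩ := generalized_tube_lemma isCompact_Icc hA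
    (hG.preimage hψc) (image_subset_iff.1 hAG)
  have hOG : ∀ t ∈ Icc τ (2 * τ), ∀ y ∈ O, φ.toFun t y ∈ G := by
    intro t ht y hy
    have : ψ (t, y) ∈ G := huO (mk_mem_prod (hu ht) hy)
    rwa [hψe t y (hτ.le.trans ht.1)] at this
  have hev := omega_attracts hc hw (hO.union hR) (hKAB.trans (union_subset_union hAO hBR))
  obtain ⟨t0, ht0⟩ := eventually_atTop.1 hev
  obtain ⟨t1, ht1, ht1O⟩ := frequently_atTop.1 (freq_omega hx hO (hAO hxA)) (max t0 0)
  have h10 : t0 ≤ t1 := (le_max_left _ _).trans ht1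
  have h1p : 0 ≤ t1 := (le_max_right _ _).trans ht1
  have hGO : ∀ t, t0 ≤ t → φ.toFun t w₀ ∈ G → φ.toFun t w₀ ∈ O := by
    intro t ht h
    rcases ht0 t ht with h' | h'
    · exact h'
    · exact absurd h' (Set.disjoint_left.1 hGR h)
  have hall : ∀ n : ℕ, ∀ s ∈ Icc ((n + 1) * τ) ((n + 2) * τ), φ.toFun (s + t1) w₀ ∈ G := by
    intro n
    induction n with
    | zero =>
      intro s hs
      simp only [Nat.cast_zero, zero_add, one_mul] at hs
      rw [φ.map_add' _ _ (hτ.le.trans hs.1) h1p]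
      exact hOG s hs _ ht1O
    | succ n ih =>
      intro s hs
      push_cast at hs
      have hs1 := hs.1
      have hs2 := hs.2
      have hn : 0 ≤ (n : ℝ) * τ := by positivity
      have h := hGO _ (by linarith) (ih (s - τ) ⟨by linarith, by linarith⟩)
      have := hOG τ ⟨le_rfl, by linarith⟩ _ h
      rw [← φ.map_add' _ _ hτ.le (by linarith)] at this
      convert this using 2
      ring
  obtain ⟨t2, ht2, ht2R⟩ := frequently_atTop.1 (freq_omega hz hR (hBR hzB)) (t1 + τ)
  refine Set.disjoint_left.1 hGR ?_ ht2R
  set s := t2 - t1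
  have hs : τ ≤ s := by simp only [s]; linarith
  have h1 : 1 ≤ s / τ := (one_le_div hτ).2 hs
  have hfl : ((⌊s / τ - 1⌋₊ : ℕ) : ℝ) ≤ s / τ - 1 := Nat.floor_le (by linarith)
  have hfl2 := Nat.lt_floor_add_one (s / τ - 1)
  have := hall ⌊s / τ - 1⌋₊ s ⟨(le_div_iff₀ hτ).1 (by linarith), (div_le_iff₀ hτ).1 (by linarith)⟩
  have e : s + t1 = t2 := by simp only [s]; ring
  rwa [e] at this

end Trap

section Cross
open FlowAux
variable {E : Type*} [NormedAddCommGroup E] [NormedSpace ℝ E]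

lemma first_eq {φ : Semiflow E} {M : Set E} {ξ : ℝ → E → E} (hf : Fl M ξ)
    (hξφ : ∀ t : ℝ, 0 ≤ t → ∀ x ∈ M, ξ t x = φ.toFun t x) {ε : ℝ} (hε : 0 < ε) {T : Set E}
    (hTM : T ⊆ M) (hu : Uniq ξ ε T)
    {h : ℝ → E} (hh : ContinuousOn h (Icc (-1 : ℝ) 1)) (hhi : InjOn h (Icc (-1 : ℝ) 1))
    (hhT : h '' Icc (-1 : ℝ) 1 = T) {pr : E → ℂ} (hpr : Continuous pr) (hpi : InjOn pr M)
    {w₀ : E} {c : Set E} (hc : IsCompact c) (hw : ∀ᶠ t in atTop, φ.toFun t w₀ ∈ c)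
    (hKM : φ.omegaLimit w₀ ⊆ M) (hKinv : ∀ t, ∀ k ∈ φ.omegaLimit w₀, ξ t k ∈ φ.omegaLimit w₀)
    {a : E} (haK : a ∈ φ.omegaLimit w₀) (ha : a ∈ T) {ℓ : ℝ} (hℓ : 0 < ℓ) (hb : ξ ℓ a ∈ T)
    (hno : ∀ t ∈ Ioo 0 ℓ, ξ t a ∉ T) : ξ ℓ a = a := by
  by_contra hab
  obtain ⟨N, Q, hN, hQ, hNQ, hstep, hin, hout⟩ :=
    first_return hf hε hTM hu hh hhi hhT hpr hpi ha hℓ hb hab hno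
  have hK := omega_compact hc hw
  refine trap hc hw (A := φ.omegaLimit w₀ ∩ pr ⁻¹' Q) (B := φ.omegaLimit w₀ \ pr ⁻¹' N)
    (hK.inter_right (hQ.preimage hpr)) (hK.diff (hN.preimage hpr)) ?_ (τ := ℓ + 1) (by linarith) ?_
    (hKinv (ε / 2) _ (hKinv ℓ _ haK)) ⟨hKinv (ε / 2) _ (hKinv ℓ _ haK), hin⟩
    (hKinv (-(ε / 2)) _ haK) ⟨hKinv (-(ε / 2)) _ haK, fun h => hout (hNQ h)⟩
  · intro k hk
    by_cases h : pr k ∈ N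
    · exact Or.inl ⟨hk, hNQ h⟩
    · exact Or.inr ⟨hk, h⟩
  · intro t ht k hk hB
    refine hB.2 ?_
    have := hstep k (hKM hk.1) hk.2 t (by linarith [ht.1])
    rwa [hξφ t (by linarith [ht.1]) k (hKM hk.1)] at this

lemma cross_eq {M : Set E} {ξ : ℝ → E → E} (hf : Fl M ξ) {ε : ℝ} (hε : 0 < ε) {T : Set E}
    (hTM : T ⊆ M) (hu : Uniq ξ ε T) {K : Set E}
    (hfirst : ∀ a ∈ K, a ∈ T → ∀ ℓ, 0 < ℓ → ξ ℓ a ∈ T → (∀ t ∈ Ioo 0 ℓ, ξ t a ∉ T) → ξ ℓ a = a)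
    {a : E} (haK : a ∈ K) (ha : a ∈ T) :
    ∀ (n : ℕ) (ℓ : ℝ), 0 ≤ ℓ → ℓ ≤ n * ε → ξ ℓ a ∈ T → ξ ℓ a = a := by
  intro n
  induction n with
  | zero =>
    intro ℓ h0 h1 _
    have : ℓ = 0 := le_antisymm (by simpa using h1) h0
    rw [this, hf.zero _ (hTM ha)]
  | succ n ih =>
    intro ℓ h0 h1 hb
    push_cast at h1
    rcases h0.eq_or_lt with h0 | h0
    · rw [← h0, hf.zero _ (hTM ha)]
    by_cases hno : ∀ t ∈ Ioo 0 ℓ, ξ t a ∉ T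
    · exact hfirst a haK ha ℓ h0 hb hno
    · push Not at hno
      obtain ⟨t, ht, htT⟩ := hno
      have hsplit : ξ ℓ a = ξ (ℓ - t) (ξ t a) := by
        rw [← hf.add _ _ _ (hTM ha)]; congr 1; ring
      have g1 : 2 * ε < t := by
        by_contra! hle
        have := gap hf hTM hu ha htT (by rw [abs_of_pos ht.1]; exact hle)
        linarith [ht.1]
      have g2 : 2 * ε < ℓ - t := by
        by_contra! hle
        have hp : 0 < ℓ - t := sub_pos.2 ht.2
        have := gap hf hTM hu htT (by rw [← hsplit]; exact hb) (by rw [abs_of_pos hp]; exact hle)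
        linarith
      have e1 := ih t ht.1.le (by linarith) htT
      rw [e1] at hsplit
      rw [hsplit]
      exact ih (ℓ - t) (by linarith) (by linarith) (by rw [← hsplit]; exact hb)

end Cross

end DynAux

/-- Lemma 2 (Bendixson-type lemma): a complete trajectory through a point of `ω(w₀)`
crosses any `ε`-transversal of the flow on `𝔄` in at most one point. -/
theorem trajectory_crosses_transversal_once
    {E : Type*} [NormedAddCommGroup E] [NormedSpace ℝ E]
    {H : Type*} [NormedAddCommGroup H] [InnerProductSpace ℝ H]
    (ι : E →L[ℝ] H) (hι : Function.Injective ι)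
    (φ : Semiflow E)
    (P : E →L[ℝ] E →L[ℝ] ℝ) (Eplus Eminus : Submodule ℝ E)
    (hH1 : Semiflow.IsH1 P Eplus Eminus)
    [FiniteDimensional ℝ ↥Eminus] (hH2 : Module.finrank ℝ ↥Eminus = 2)
    (δ τV ν : ℝ) (hH3 : φ.IsH3 ι P δ τV ν)
    (hCOM : φ.IsCOM) (hS : φ.IsSmoothing ι)
    (hne : (φ.amenableSet ι ν).Nonempty)
    (ξ : ℝ → E → E)
    (hξmaps : ∀ t : ℝ, Set.MapsTo (ξ t) (φ.amenableSet ι ν) (φ.amenableSet ι ν))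
    (hξzero : ∀ x ∈ φ.amenableSet ι ν, ξ 0 x = x)
    (hξadd : ∀ t s : ℝ, ∀ x ∈ φ.amenableSet ι ν, ξ (t + s) x = ξ t (ξ s x))
    (hξcont : ContinuousOn (fun p : ℝ × E => ξ p.1 p.2)
      ((Set.univ : Set ℝ) ×ˢ φ.amenableSet ι ν))
    (hξφ : ∀ t : ℝ, 0 ≤ t → ∀ x ∈ φ.amenableSet ι ν, ξ t x = φ.toFun t x)
    (ε : ℝ) (hε : 0 < ε) (x₀ : E) (T : Set E)
    (hT : IsTransversalOn (φ.amenableSet ι ν) ξ ε x₀ T)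
    (w₀ : E) (hbdd : IsBounded (φ.orbit w₀))
    (v₀ : E) (hv₀ : v₀ ∈ φ.omegaLimit w₀)
    (v : ℝ → E) (hv : φ.IsCompleteTrajectory v) (hv0 : v 0 = v₀) :
    ∀ t₁ t₂ : ℝ, v t₁ ∈ T → v t₂ ∈ T → v t₁ = v t₂ := by
  have hν : 0 < ν := hH3.2.2.1
  have hf : FlowAux.Fl (φ.amenableSet ι ν) ξ := ⟨hξmaps, hξzero, hξadd, hξcont⟩
  obtain ⟨hsec, h, hh, hhi, hhT, -⟩ := hT
  obtain ⟨-, hTM, -, huniq⟩ := hsec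
  have hu : FlowAux.Uniq ξ ε T := by
    intro t ht t' ht' q hq q' hq' heq
    have hy : ξ t q ∈ ⋃ t ∈ Set.Icc (-ε) ε, ξ t '' T := mem_biUnion ht ⟨q, hq, rfl⟩
    have := (huniq _ hy).unique (y₁ := (t, q)) (y₂ := (t', q')) ⟨ht, hq, rfl⟩ ⟨ht', hq', heq.symm⟩
    exact ⟨congrArg Prod.fst this, congrArg Prod.snd this⟩
  obtain ⟨-, hEp, -, hcompl, hpos, -⟩ := hH1
  obtain ⟨pr, hpr, hprk⟩ := DynAux.exists_proj Eplus Eminus hEp hcompl hH2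
  have hpi : InjOn pr (φ.amenableSet ι ν) := by
    rintro _ ⟨u₁, hu1, rfl⟩ _ ⟨u₂, hu2, rfl⟩ hab
    by_contra hne'
    have h1 := DynAux.neg_of_amenable ι hι φ P δ τV ν hH3 hS hu1 hu2 hne'
    have h2 := hpos _ (hprk _ _ hab) (sub_ne_zero.2 hne')
    linarith
  obtain ⟨c, hc, hw⟩ := DynAux.exists_cpt hCOM hbdd
  have hKM : φ.omegaLimit w₀ ⊆ φ.amenableSet ι ν := fun k hk =>
    DynAux.omega_amenable ι hν hc hw hk
  have hKinv : ∀ t, ∀ k ∈ φ.omegaLimit w₀, ξ t k ∈ φ.omegaLimit w₀ := by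
    intro t k hk
    rcases le_total 0 t with ht | ht
    · rw [hξφ t ht k (hKM hk)]
      exact DynAux.omega_fwd hk ht
    · obtain ⟨k', hk', hkk⟩ := DynAux.omega_bwd hc hw hk (neg_nonneg.2 ht)
      rw [← hξφ (-t) (neg_nonneg.2 ht) k' (hKM hk')] at hkk
      have := hf.neg (hKM hk') hkk
      rw [neg_neg] at this
      rwa [this]
  have main : ∀ t₁ t₂ : ℝ, t₁ ≤ t₂ → v t₁ ∈ T → v t₂ ∈ T → v t₁ = v t₂ := by
    intro t₁ t₂ hle h1 h2
    have hv2 : v t₂ = ξ (t₂ - t₁) (v t₁) := by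
      rw [hξφ _ (sub_nonneg.2 hle) _ (hTM h1), ← hv.2 _ (sub_nonneg.2 hle)]
      congr 1; ring
    have haK : v t₁ ∈ φ.omegaLimit w₀ := by
      rcases le_total 0 t₁ with ht | ht
      · have := hv.2 t₁ ht 0
        rw [add_zero, hv0] at this
        rw [this]
        exact DynAux.omega_fwd hv₀ ht
      · have := hv.2 (-t₁) (neg_nonneg.2 ht) t₁
        rw [neg_add_cancel, hv0, ← hξφ _ (neg_nonneg.2 ht) _ (hTM h1)] at this
        have := hf.neg (hTM h1) this.symm
        rw [neg_neg] at this
        rw [← this]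
        exact hKinv _ _ hv₀
    obtain ⟨n, hn⟩ := exists_nat_ge ((t₂ - t₁) / ε)
    rw [hv2] at h2 ⊢
    refine (DynAux.cross_eq hf hε hTM hu (K := φ.omegaLimit w₀) ?_ haK h1 n (t₂ - t₁)
      (sub_nonneg.2 hle) ((div_le_iff₀ hε).1 hn) h2).symm
    intro a haK ha ℓ hℓ hb hno
    exact DynAux.first_eq hf hξφ hε hTM hu hh hhi hhT hpr hpi hc hw hKM hKinv haK ha hℓ hb hno
  intro t₁ t₂ h1 h2
  rcases le_total t₁ t₂ with hle | hle
  · exact main t₁ t₂ hle h1 h2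
  · exact (main t₂ t₁ hle h2 h1).symm
end

section
/- Let φ be a semiflow on E satisfying (H1), (H2) with j = 2, (H3), (COM) and (S), and let Π : E → E⁻ be the V-orthogonal projector. Let v₁, v₂ ∈ E be periodic points whose orbits γ(v₁) and γ(v₂) are distinct. Then there exists δ = δ(v₁,v₂) > 0 such that for every w₀ ∈ E with dist_E(w₀, γ(v₁)) < δ and every t ≥ 0, one has Π φ^t(w₀) ∉ Π γ(v₂). -/
open Set Filter Topology MeasureTheory Bornology

namespace Semiflow

section Helpers

variable {E : Type*} [NormedAddCommGroup E] [NormedSpace ℝ E]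

theorem aux_continuous (φ : Semiflow E) :
    Continuous (fun p : ℝ × E => φ.toFun (max p.1 0) p.2) := by
  have h : Continuous (fun p : ℝ × E => ((max p.1 0, p.2) : ℝ × E)) := by fun_prop
  exact φ.continuousOn'.comp_continuous h (fun p => ⟨Set.mem_Ici.2 (le_max_right _ _), mem_univ _⟩)

theorem aux_period (φ : Semiflow E) {v : E} {σ : ℝ} (hσ : 0 < σ) (hv : φ.toFun σ v = v) (n : ℕ) :
    φ.toFun (n * σ) v = v := by
  induction n with
  | zero => simpa using φ.map_zero' v
  | succ k ih =>
    have : ((k + 1 : ℕ) : ℝ) * σ = k * σ + σ := by push_cast; ring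
    rw [this, φ.map_add' _ _ (by positivity) hσ.le, hv, ih]

theorem aux_period' (φ : Semiflow E) {v : E} {σ : ℝ} (hσ : 0 < σ) (hv : φ.toFun σ v = v) (n : ℕ)
    {t : ℝ} (ht : 0 ≤ t) :
    φ.toFun (t + n * σ) v = φ.toFun t v := by
  rw [φ.map_add' _ _ ht (by positivity), φ.aux_period hσ hv]

theorem aux_orbit_compact (φ : Semiflow E) {v : E} (hv : φ.IsPeriodicPt v) :
    IsCompact (φ.orbit v) := by
  obtain ⟨_, σ, hσ, hv⟩ := hv
  have : φ.orbit v = (fun t : ℝ => φ.toFun (max t 0) v) '' Icc 0 σ := by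
    ext w
    constructor
    · rintro ⟨t, ht, rfl⟩
      have h1 : 0 ≤ t - ⌊t / σ⌋₊ * σ := by
        have := Nat.floor_le (div_nonneg ht hσ.le)
        rw [le_div_iff₀ hσ] at this
        linarith
      have h2 : t - ⌊t / σ⌋₊ * σ ≤ σ := by
        have := Nat.lt_floor_add_one (t / σ)
        rw [div_lt_iff₀ hσ] at this
        linarith
      refine ⟨t - ⌊t / σ⌋₊ * σ, ⟨h1, h2⟩, ?_⟩
      have := φ.aux_period' hσ hv ⌊t / σ⌋₊ h1
      simp only [max_eq_left h1]
      rw [← this, sub_add_cancel]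
    · rintro ⟨t, ht, rfl⟩
      exact ⟨max t 0, le_max_right _ _, rfl⟩
  rw [this]
  refine isCompact_Icc.image ?_
  exact φ.aux_continuous.comp (by fun_prop : Continuous (fun t : ℝ => ((t, v) : ℝ × E)))

theorem aux_orbit_back (φ : Semiflow E) {v : E} (hv : φ.IsPeriodicPt v) {T : ℝ} (hT : 0 ≤ T)
    {x : E} (hx : x ∈ φ.orbit v) : ∃ x' ∈ φ.orbit v, φ.toFun T x' = x := by
  obtain ⟨_, σ, hσ, hv⟩ := hv
  obtain ⟨t, ht, rfl⟩ := hx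
  obtain ⟨n, hn⟩ := exists_nat_ge (T / σ)
  rw [div_le_iff₀ hσ] at hn
  have h0 : 0 ≤ t + n * σ - T := by linarith
  refine ⟨φ.toFun (t + n * σ - T) v, ⟨_, h0, rfl⟩, ?_⟩
  rw [← φ.map_add' _ _ hT h0, ← φ.aux_period' hσ hv n ht]
  congr 1
  ring

theorem aux_orbit_forward (φ : Semiflow E) {v : E} {T : ℝ} (hT : 0 ≤ T)
    {x : E} (hx : x ∈ φ.orbit v) : φ.toFun T x ∈ φ.orbit v := by
  obtain ⟨t, ht, rfl⟩ := hx
  exact ⟨T + t, by positivity, φ.map_add' _ _ hT ht v⟩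

theorem aux_orbit_sub (φ : Semiflow E) {v w z : E} (hv : φ.IsPeriodicPt v)
    (hz : z ∈ φ.orbit v) (hz' : z ∈ φ.orbit w) : φ.orbit v ⊆ φ.orbit w := by
  obtain ⟨_, σ, hσ, hv⟩ := hv
  obtain ⟨t, ht, rfl⟩ := hz
  obtain ⟨n, hn⟩ := exists_nat_ge (t / σ)
  rw [div_le_iff₀ hσ] at hn
  have h0 : 0 ≤ n * σ - t := by linarith
  have hvw : v ∈ φ.orbit w := by
    have := φ.aux_orbit_forward h0 hz'
    rwa [← φ.map_add' _ _ h0 ht, sub_add_cancel, φ.aux_period hσ hv] at this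
  rintro x ⟨s, hs, rfl⟩
  exact φ.aux_orbit_forward hs hvw

theorem aux_ker_nonneg {P : E →L[ℝ] E →L[ℝ] ℝ} {Eplus Eminus : Submodule ℝ E}
    (hH1 : IsH1 P Eplus Eminus) {v : E} (hv : ∀ w ∈ Eminus, P w v = 0) : 0 ≤ P v v := by
  obtain ⟨hsym, _, _, hc, hp, hm⟩ := hH1
  obtain ⟨a, ha, b, hb, rfl⟩ : ∃ a ∈ Eplus, ∃ b ∈ Eminus, a + b = v :=
    Submodule.mem_sup.1 (by rw [hc.sup_eq_top]; trivial)
  have h1 := hv b hb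
  have h2 : 0 ≤ P a a := by
    by_cases h : a = 0
    · simp [h]
    · exact (hp a ha h).le
  have h3 : P b b ≤ 0 := by
    by_cases h : b = 0
    · simp [h]
    · exact (hm b hb h).le
  have h4 := hsym a b
  simp only [map_add, add_apply] at h1 ⊢
  linarith

theorem aux_neg {H : Type*} [NormedAddCommGroup H] [InnerProductSpace ℝ H]
    (ι : E →L[ℝ] H) (hι : Function.Injective ι)
    (φ : Semiflow E) (P : E →L[ℝ] E →L[ℝ] ℝ) (δ τV ν : ℝ) (hH3 : φ.IsH3 ι P δ τV ν)
    (v₁ v₂ : E) (h₁ : φ.IsPeriodicPt v₁) (h₂ : φ.IsPeriodicPt v₂)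
    (hne : φ.orbit v₁ ≠ φ.orbit v₂) :
    ∀ x ∈ φ.orbit v₁, ∀ y ∈ φ.orbit v₂, P (x - y) (x - y) < 0 := by
  obtain ⟨hδ, hτ, hν, h3⟩ := hH3
  have hK : IsCompact (φ.orbit v₁ ×ˢ φ.orbit v₂) :=
    (φ.aux_orbit_compact h₁).prod (φ.aux_orbit_compact h₂)
  have hKne : (φ.orbit v₁ ×ˢ φ.orbit v₂).Nonempty :=
    ⟨(φ.toFun 0 v₁, φ.toFun 0 v₂), ⟨0, le_rfl, rfl⟩, ⟨0, le_rfl, rfl⟩⟩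
  obtain ⟨p, hp, hpmin⟩ := hK.exists_isMinOn hKne
    (f := fun p : E × E => ‖ι p.1 - ι p.2‖ ^ 2) (by fun_prop)
  obtain ⟨M, hM⟩ := hK.bddAbove_image
    (f := fun p : E × E => P (p.1 - p.2) (p.1 - p.2)) (by fun_prop)
  set m := ‖ι p.1 - ι p.2‖ ^ 2 with hm
  have hmpos : 0 < m := by
    have : p.1 ≠ p.2 := by
      intro h
      apply hne
      have a := hp.1
      have b := hp.2
      rw [← h] at b
      exact (φ.aux_orbit_sub h₁ a b).antisymm (φ.aux_orbit_sub h₂ b a)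
    have : ι p.1 - ι p.2 ≠ 0 := sub_ne_zero.2 (fun h => this (hι h))
    positivity
  intro x hx y hy
  obtain ⟨T, hT⟩ := exists_gt (max (max τV 0) (M / (δ * m)))
  have hT1 : τV < T := lt_of_le_of_lt ((le_max_left _ _).trans (le_max_left _ _)) hT
  have hT0 : 0 < T := hτ.trans_lt hT1
  have hT2 : M < T * (δ * m) := by
    rw [← div_lt_iff₀ (by positivity)]
    exact lt_of_le_of_lt (le_max_right _ _) hT
  obtain ⟨x', hx', rfl⟩ := φ.aux_orbit_back h₁ hT0.le hx
  obtain ⟨y', hy', rfl⟩ := φ.aux_orbit_back h₂ hT0.le hy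
  have key := h3 x' y' 0 T le_rfl hT0.le (by linarith)
  have hMb : P (x' - y') (x' - y') ≤ M := hM ⟨(x', y'), ⟨hx', hy'⟩, rfl⟩
  have hcont : ∀ z : E, ContinuousOn (fun s => φ.toFun s z) (Icc 0 T) := fun z =>
    φ.continuousOn'.comp (f := fun s : ℝ => ((s, z) : ℝ × E)) (by fun_prop)
      (fun s hs => ⟨hs.1, mem_univ _⟩)
  have hint : T * m ≤ ∫ s in (0 : ℝ)..T,
      Real.exp (2 * ν * s) * ‖ι (φ.toFun s x') - ι (φ.toFun s y')‖ ^ 2 := by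
    have : T * m = ∫ s in (0 : ℝ)..T, m := by simp
    rw [this]
    refine intervalIntegral.integral_mono_on hT0.le (by simp) ?_ ?_
    · apply ContinuousOn.intervalIntegrable
      rw [uIcc_of_le hT0.le]
      have a := hcont x'
      have b := hcont y'
      fun_prop
    · intro s hs
      have h1 : m ≤ ‖ι (φ.toFun s x') - ι (φ.toFun s y')‖ ^ 2 :=
        hpmin (a := (φ.toFun s x', φ.toFun s y'))
          ⟨φ.aux_orbit_forward hs.1 hx', φ.aux_orbit_forward hs.1 hy'⟩
      have h2 : 1 ≤ Real.exp (2 * ν * s) :=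
        Real.one_le_exp (by have := hs.1; positivity)
      nlinarith
  simp only [φ.map_zero', mul_zero, Real.exp_zero, one_mul] at key
  have h5 : Real.exp (2 * ν * T) * P (φ.toFun T x' - φ.toFun T y') (φ.toFun T x' - φ.toFun T y')
      < 0 := by
    nlinarith
  by_contra hcon
  push Not at hcon
  have := mul_nonneg (Real.exp_pos (2 * ν * T)).le hcon
  linarith

end Helpers

end Semiflow

/-- Lemma 3: two distinct periodic orbits are separated: points starting close to
`γ(v₁)` never project under `Π` into `Π γ(v₂)`. -/
theorem periodic_orbits_separated
    {E : Type*} [NormedAddCommGroup E] [NormedSpace ℝ E]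
    {H : Type*} [NormedAddCommGroup H] [InnerProductSpace ℝ H]
    (ι : E →L[ℝ] H) (hι : Function.Injective ι)
    (φ : Semiflow E)
    (P : E →L[ℝ] E →L[ℝ] ℝ) (Eplus Eminus : Submodule ℝ E)
    (hH1 : Semiflow.IsH1 P Eplus Eminus)
    [FiniteDimensional ℝ ↥Eminus] (hH2 : Module.finrank ℝ ↥Eminus = 2)
    (δ τV ν : ℝ) (hH3 : φ.IsH3 ι P δ τV ν)
    (hCOM : φ.IsCOM) (hS : φ.IsSmoothing ι)
    (Pi : E → E) (hPi : Semiflow.IsVProjector P Eminus Pi)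
    (v₁ v₂ : E) (h₁ : φ.IsPeriodicPt v₁) (h₂ : φ.IsPeriodicPt v₂)
    (hne : φ.orbit v₁ ≠ φ.orbit v₂) :
    ∃ δ : ℝ, 0 < δ ∧ ∀ w₀ : E, Metric.infDist w₀ (φ.orbit v₁) < δ →
      ∀ t : ℝ, 0 ≤ t → Pi (φ.toFun t w₀) ∉ Pi '' φ.orbit v₂ := by
  have hneg := φ.aux_neg ι hι P δ τV ν hH3 v₁ v₂ h₁ h₂ hne
  obtain ⟨hδ, hτ, hν, h3⟩ := hH3
  have hK2 : IsCompact (Icc (0 : ℝ) τV ×ˢ φ.orbit v₂) :=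
    isCompact_Icc.prod (φ.aux_orbit_compact h₂)
  have hK1 := φ.aux_orbit_compact h₁
  have hF : Continuous (fun q : E × (ℝ × E) => φ.toFun (max q.2.1 0) q.1 - q.2.2) :=
    (φ.aux_continuous.comp (by fun_prop :
      Continuous (fun q : E × (ℝ × E) => ((q.2.1, q.1) : ℝ × E)))).sub (by fun_prop)
  have hO : IsOpen {q : E × (ℝ × E) | P (φ.toFun (max q.2.1 0) q.1 - q.2.2)
      (φ.toFun (max q.2.1 0) q.1 - q.2.2) < 0} :=
    isOpen_lt ((P.continuous.comp hF).clm_apply hF) continuous_const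
  obtain ⟨U, W, hU, -, hKU, hKW, hUW⟩ := generalized_tube_lemma hK1 hK2 hO (by
    rintro ⟨x, t, y⟩ ⟨hx, ht, hy⟩
    exact hneg _ (φ.aux_orbit_forward (le_max_right _ _) hx) _ hy)
  obtain ⟨ε, hε, hεU⟩ := hK1.exists_thickening_subset_open hU hKU
  have hnon : (φ.orbit v₁).Nonempty := ⟨_, 0, le_rfl, rfl⟩
  refine ⟨ε, hε, fun w₀ hw₀ t ht hmem => ?_⟩
  have hw : ∀ s ∈ Icc (0 : ℝ) τV, ∀ y ∈ φ.orbit v₂,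
      P (φ.toFun s w₀ - y) (φ.toFun s w₀ - y) < 0 := by
    intro s hs y hy
    have h := @hUW (w₀, s, y) ⟨hεU ((Metric.mem_thickening_iff_infDist_lt hnon).2 hw₀), hKW ⟨hs, hy⟩⟩
    simpa [max_eq_left hs.1] using h
  obtain ⟨y, hy, hyP⟩ := hmem
  have hpos : 0 ≤ P (φ.toFun t w₀ - y) (φ.toFun t w₀ - y) := by
    refine Semiflow.aux_ker_nonneg hH1 (fun w hw => ?_)
    rw [map_sub, (hPi _).2 w hw, (hPi y).2 w hw, hyP, sub_self]
  rcases le_or_gt t τV with h | h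
  · exact absurd hpos (not_le.2 (hw t ⟨ht, h⟩ y hy))
  · obtain ⟨y', hy', rfl⟩ := φ.aux_orbit_back h₂ ht hy
    have key := h3 w₀ y' 0 t le_rfl ht (by linarith)
    have h0 := hw 0 ⟨le_rfl, hτ⟩ y' hy'
    have hint : 0 ≤ ∫ s in (0 : ℝ)..t,
        Real.exp (2 * ν * s) * ‖ι (φ.toFun s w₀) - ι (φ.toFun s y')‖ ^ 2 :=
      intervalIntegral.integral_nonneg ht (fun s _ => by positivity)
    simp only [φ.map_zero', mul_zero, Real.exp_zero, one_mul] at key h0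
    have h6 := mul_nonneg (Real.exp_pos (2 * ν * t)).le hpos
    nlinarith [mul_nonneg hδ.le hint]
end
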